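/- arXiv:1509.05605 — 18 statements merged into one kernel-verified Lean document; each statement's English description precedes it below -/
import Mathlib

section
/- Suppose that ⟨x_n − T(x_n), d_n⟩ < 0 for all n ∈ ℕ. Then the series ∑_{n=0}^∞ (⟨x_n − T(x_n), d_n⟩ / ‖d_n‖)² is finite (the Zoutendijk-type condition holds). -/
open RealInnerProductSpace Filter

/-- A nonnegative sequence dominated by the decrements of a nonnegative sequence is summable. -/
theorem summable_of_mul_le_sub_succ {f G : ℕ → ℝ} {c : ℝ} (hc : 0 < c) (hf : ∀ n, 0 ≤ f n)
    (hG : ∀ n, 0 ≤ G n) (h : ∀ n, c * f n ≤ G n - G (n + 1)) : Summable f := by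
  refine summable_of_sum_range_le (c := G 0 / c) hf fun n => ?_
  rw [le_div_iff₀' hc, Finset.mul_sum]
  calc ∑ i ∈ Finset.range n, c * f i
      ≤ ∑ i ∈ Finset.range n, (G i - G (i + 1)) := Finset.sum_le_sum fun i _ => h i
    _ = G 0 - G n := Finset.sum_range_sub' G n
    _ ≤ G 0 := sub_le_self _ (hG n)

/-- The residual `x - T x` of a nonexpansive map is `2`-Lipschitz. -/
theorem norm_residual_sub_residual_le {E : Type*} [SeminormedAddCommGroup E] {T : E → E}
    (hT : ∀ x y : E, ‖T x - T y‖ ≤ ‖x - y‖) (x y : E) :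
    ‖(x - T x) - (y - T y)‖ ≤ 2 * ‖x - y‖ := by
  have h : (x - T x) - (y - T y) = (x - y) - (T x - T y) := by abel
  rw [h]
  linarith [norm_sub_le (x - y) (T x - T y), hT x y]

/-- The curvature condition bounds the step size from below. -/
theorem curvature_le_two_mul_step {E : Type*} [SeminormedAddCommGroup E] [InnerProductSpace ℝ E]
    {T : E → E} (hT : ∀ x y : E, ‖T x - T y‖ ≤ ‖x - y‖) {σ a : ℝ} (ha : 0 ≤ a) {x d : E}
    (hW : σ * ⟪x - T x, d⟫ ≤ ⟪(x + a • d) - T (x + a • d), d⟫) :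
    (1 - σ) * -⟪x - T x, d⟫ ≤ 2 * a * ‖d‖ ^ 2 := by
  have hcs := real_inner_le_norm (((x + a • d) - T (x + a • d)) - (x - T x)) d
  rw [inner_sub_left] at hcs
  have hlip := norm_residual_sub_residual_le hT (x + a • d) x
  rw [add_sub_cancel_left, norm_smul, Real.norm_of_nonneg ha] at hlip
  have := mul_le_mul_of_nonneg_right hlip (norm_nonneg d)
  linarith

/-- Zoutendijk-type condition: under the Wolfe-type line search conditions and
descent directions, the series ∑ (⟪x n − T (x n), d n⟫ / ‖d n‖)² is finite. -/
theorem stmt_0 {H : Type*} [NormedAddCommGroup H] [InnerProductSpace ℝ H] [CompleteSpace H]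
    (T : H → H) (hT : ∀ x y : H, ‖T x - T y‖ ≤ ‖x - y‖) (hFix : ∃ p : H, T p = p)
    (δ σ : ℝ) (hδ : δ ∈ Set.Ioo (0:ℝ) 1) (hσ : σ ∈ Set.Ioo (0:ℝ) 1) (hδσ : δ ≤ σ)
    (x d : ℕ → H) (α : ℕ → ℝ) (hα : ∀ n, α n ∈ Set.Ioc (0:ℝ) 1)
    (hx : ∀ n, x (n+1) = x n + α n • d n)
    (hA : ∀ n, ‖x (n+1) - T (x (n+1))‖ ^ 2 - ‖x n - T (x n)‖ ^ 2
      ≤ δ * α n * ⟪x n - T (x n), d n⟫)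
    (hW : ∀ n, σ * ⟪x n - T (x n), d n⟫ ≤ ⟪x (n+1) - T (x (n+1)), d n⟫)
    (hneg : ∀ n, ⟪x n - T (x n), d n⟫ < 0) :
    Summable (fun n => (⟪x n - T (x n), d n⟫ / ‖d n‖) ^ 2) := by
  refine summable_of_mul_le_sub_succ (c := δ * (1 - σ) / 2) (G := fun n => ‖x n - T (x n)‖ ^ 2)
    (half_pos (mul_pos hδ.1 (sub_pos.2 hσ.2))) (fun n => sq_nonneg _) (fun n => sq_nonneg _)
    fun n => ?_
  have hd : 0 < ‖d n‖ := norm_pos_iff.2 fun h => by simpa [h] using hneg n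
  have hstep := curvature_le_two_mul_step hT (hα n).1.le (hx n ▸ hW n)
  have hdecr := hA n
  set g := ⟪x n - T (x n), d n⟫
  have hg : 0 < δ * -g := mul_pos hδ.1 (neg_pos.2 (hneg n))
  have key : δ * (1 - σ) / 2 * (g / ‖d n‖) ^ 2 ≤ δ * -g * α n := by
    rw [div_pow, mul_div_assoc', div_le_iff₀ (pow_pos hd 2)]
    linarith [mul_le_mul_of_nonneg_left hstep hg.le]
  linarith
end

section
/- Suppose that d_n = −(x_n − T(x_n)) for all n ∈ ℕ (the steepest-descent direction, i.e., β_n = 0) and that ‖x_n − T(x_n)‖ ≠ 0 for all n ∈ ℕ. Then lim_{n→∞} ‖x_n − T(x_n)‖ = 0. -/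
open RealInnerProductSpace Filter

/-- The residual `x - T x` of a nonexpansive map is 2-Lipschitz. -/
lemma norm_residual_sub_le {E : Type*} [NormedAddCommGroup E] {T : E → E}
    (hT : ∀ x y : E, ‖T x - T y‖ ≤ ‖x - y‖) (x y : E) :
    ‖(x - T x) - (y - T y)‖ ≤ 2 * ‖x - y‖ := by
  have h : (x - T x) - (y - T y) = (x - y) - (T x - T y) := by abel
  rw [h]
  linarith [norm_sub_le (x - y) (T x - T y), hT x y]

/-- The curvature condition along a negative residual step bounds the step size from below. -/
lemma step_size_lower_bound {E : Type*} [NormedAddCommGroup E] [InnerProductSpace ℝ E]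
    {r s : E} {a σ : ℝ} (hr : ‖r‖ ≠ 0) (hs : ‖r - s‖ ≤ 2 * (a * ‖r‖))
    (hW : ⟪s, r⟫ ≤ σ * ‖r‖ ^ 2) : (1 - σ) / 2 ≤ a := by
  have hpos : 0 < ‖r‖ ^ 2 := by positivity
  have h1 : ⟪r - s, r⟫ ≤ ‖r - s‖ * ‖r‖ := real_inner_le_norm _ _
  rw [inner_sub_left, real_inner_self_eq_norm_sq] at h1
  have h2 : ‖r - s‖ * ‖r‖ ≤ 2 * (a * ‖r‖) * ‖r‖ := by gcongr
  have h3 : (1 - σ) * ‖r‖ ^ 2 ≤ (2 * a) * ‖r‖ ^ 2 := by linarith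
  linarith [le_of_mul_le_mul_right h3 hpos]

/-- A real sequence whose squares contract by a fixed factor below one tends to zero. -/
lemma tendsto_zero_of_sq_le_mul_sq {u : ℕ → ℝ} {q : ℝ} (hq₀ : 0 ≤ q)
    (hq₁ : q < 1) (h : ∀ n, u (n + 1) ^ 2 ≤ q * u n ^ 2) :
    Tendsto u atTop (nhds 0) := by
  have hbound : ∀ n, u n ^ 2 ≤ q ^ n * u 0 ^ 2 := by
    intro n
    induction n with
    | zero => simp
    | succ k ih =>
      calc u (k + 1) ^ 2 ≤ q * u k ^ 2 := h k
        _ ≤ q * (q ^ k * u 0 ^ 2) := by gcongr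
        _ = q ^ (k + 1) * u 0 ^ 2 := by ring
  have hgeom : Tendsto (fun n => q ^ n * u 0 ^ 2) atTop (nhds 0) := by
    simpa using (tendsto_pow_atTop_nhds_zero_of_lt_one hq₀ hq₁).mul_const (u 0 ^ 2)
  have hsq := squeeze_zero (fun n => sq_nonneg (u n)) hbound hgeom
  exact (tendsto_zero_iff_abs_tendsto_zero u).2
    (by simpa [Function.comp_def, Real.sqrt_sq_eq_abs] using hsq.sqrt)

/-- Steepest-descent direction case: ‖x n − T (x n)‖ → 0. -/
theorem stmt_1 {H : Type*} [NormedAddCommGroup H] [InnerProductSpace ℝ H] [CompleteSpace H]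
    (T : H → H) (hT : ∀ x y : H, ‖T x - T y‖ ≤ ‖x - y‖) (hFix : ∃ p : H, T p = p)
    (δ σ : ℝ) (hδ : δ ∈ Set.Ioo (0:ℝ) 1) (hσ : σ ∈ Set.Ioo (0:ℝ) 1) (hδσ : δ ≤ σ)
    (x d : ℕ → H) (α : ℕ → ℝ) (hα : ∀ n, α n ∈ Set.Ioc (0:ℝ) 1)
    (hx : ∀ n, x (n+1) = x n + α n • d n)
    (hA : ∀ n, ‖x (n+1) - T (x (n+1))‖ ^ 2 - ‖x n - T (x n)‖ ^ 2
      ≤ δ * α n * ⟪x n - T (x n), d n⟫)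
    (hW : ∀ n, σ * ⟪x n - T (x n), d n⟫ ≤ ⟪x (n+1) - T (x (n+1)), d n⟫)
    (hd : ∀ n, d n = -(x n - T (x n)))
    (hnz : ∀ n, ‖x n - T (x n)‖ ≠ 0) :
    Tendsto (fun n => ‖x n - T (x n)‖) atTop (nhds 0) := by
  obtain ⟨hδ₀, hδ₁⟩ := hδ
  obtain ⟨hσ₀, hσ₁⟩ := hσ
  have hc : 0 < δ * ((1 - σ) / 2) := mul_pos hδ₀ (by linarith)
  refine tendsto_zero_of_sq_le_mul_sq (q := 1 - δ * ((1 - σ) / 2)) (by nlinarith)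
    (by linarith) fun n => ?_
  have hstep : ‖(x n - T (x n)) - (x (n + 1) - T (x (n + 1)))‖
      ≤ 2 * (α n * ‖x n - T (x n)‖) := by
    have hdist : ‖x n - x (n + 1)‖ = α n * ‖x n - T (x n)‖ := by
      rw [hx, hd, sub_add_cancel_left, norm_neg, norm_smul, norm_neg,
        Real.norm_of_nonneg (hα n).1.le]
    exact hdist ▸ norm_residual_sub_le hT _ _
  have hcurv := hW n
  have harmijo := hA n
  rw [hd, inner_neg_right, real_inner_self_eq_norm_sq] at harmijo hcurv
  rw [inner_neg_right] at hcurv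
  have hα_lower : (1 - σ) / 2 ≤ α n :=
    step_size_lower_bound (hnz n) hstep (by linarith)
  have hdecrease : δ * ((1 - σ) / 2) * ‖x n - T (x n)‖ ^ 2
      ≤ δ * α n * ‖x n - T (x n)‖ ^ 2 := by gcongr
  linarith
end

section
/- Suppose that d_n = −(x_n − T(x_n)) for all n ∈ ℕ (the steepest-descent direction, i.e., β_n = 0) and that ‖x_n − T(x_n)‖ ≠ 0 for all n ∈ ℕ. Then the sequence (x_n)_{n∈ℕ} converges weakly to a fixed point of T, i.e., there exists x* ∈ Fix(T) such that ⟨x_n, y⟩ → ⟨x*, y⟩ for every y ∈ H. -/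
open RealInnerProductSpace Filter

/-- A curvature condition along a damped step of a nonexpansive map bounds the step size below. -/
lemma step_size_lower_bound_s3 {H : Type*} [NormedAddCommGroup H] [InnerProductSpace ℝ H]
    {T : H → H} (hT : ∀ x y : H, ‖T x - T y‖ ≤ ‖x - y‖) {x z : H} {σ a : ℝ} (ha : 0 ≤ a)
    (hz : z = x - a • (x - T x)) (hx : x - T x ≠ 0)
    (hW : ⟪z - T z, x - T x⟫ ≤ σ * ‖x - T x‖ ^ 2) : (1 - σ) / 2 ≤ a := by
  have hzx : ‖x - z‖ = a * ‖x - T x‖ := by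
    rw [hz, sub_sub_cancel, norm_smul, Real.norm_of_nonneg ha]
  have hdiff : ‖(x - T x) - (z - T z)‖ ≤ 2 * a * ‖x - T x‖ := by
    calc ‖(x - T x) - (z - T z)‖ = ‖(x - z) - (T x - T z)‖ := by congr 1; abel
      _ ≤ ‖x - z‖ + ‖T x - T z‖ := norm_sub_le _ _
      _ ≤ 2 * a * ‖x - T x‖ := by linarith [hT x z]
  have hcs := real_inner_le_norm ((x - T x) - (z - T z)) (x - T x)
  rw [inner_sub_left, real_inner_self_eq_norm_sq] at hcs
  have hpos : 0 < ‖x - T x‖ := norm_pos_iff.mpr hx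
  have hmul := mul_le_mul_of_nonneg_right hdiff hpos.le
  have key : (1 - σ) * ‖x - T x‖ ^ 2 ≤ 2 * a * ‖x - T x‖ ^ 2 := by linarith
  linarith [le_of_mul_le_mul_right key (by positivity)]

/-- Geometrically decaying residuals that control the steps force convergence to a fixed point. -/
lemma exists_fixed_point_tendsto_of_geometric_residual {H : Type*} [NormedAddCommGroup H]
    [CompleteSpace H] {T : H → H} (hT : Continuous T) {x : ℕ → H} {k : ℝ} (hk₀ : 0 ≤ k)
    (hk₁ : k < 1) (hstep : ∀ n, ‖x n - x (n + 1)‖ ≤ ‖x n - T (x n)‖)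
    (hres : ∀ n, ‖x (n + 1) - T (x (n + 1))‖ ≤ k * ‖x n - T (x n)‖) :
    ∃ p, T p = p ∧ Tendsto x atTop (nhds p) := by
  have hgeo : ∀ n, ‖x n - T (x n)‖ ≤ ‖x 0 - T (x 0)‖ * k ^ n := by
    intro n
    induction n with
    | zero => simp
    | succ n ih =>
      calc _ ≤ k * ‖x n - T (x n)‖ := hres n
        _ ≤ k * (‖x 0 - T (x 0)‖ * k ^ n) := by gcongr
        _ = _ := by ring
  obtain ⟨p, hp⟩ := cauchySeq_tendsto_of_complete <|
    cauchySeq_of_le_geometric (f := x) k ‖x 0 - T (x 0)‖ hk₁ fun n => by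
      rw [dist_eq_norm]
      exact (hstep n).trans (hgeo n)
  have hzero : Tendsto (fun n => x n - T (x n)) atTop (nhds 0) := by
    refine squeeze_zero_norm hgeo ?_
    simpa using (tendsto_pow_atTop_nhds_zero_of_lt_one hk₀ hk₁).const_mul ‖x 0 - T (x 0)‖
  have hlim := hp.sub ((hT.tendsto p).comp hp)
  exact ⟨p, (sub_eq_zero.mp (tendsto_nhds_unique hlim hzero)).symm, hp⟩

/-- Steepest-descent direction case: (x n) converges weakly to a fixed point of T. -/
theorem stmt_3 {H : Type*} [NormedAddCommGroup H] [InnerProductSpace ℝ H] [CompleteSpace H]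
    (T : H → H) (hT : ∀ x y : H, ‖T x - T y‖ ≤ ‖x - y‖) (hFix : ∃ p : H, T p = p)
    (δ σ : ℝ) (hδ : δ ∈ Set.Ioo (0:ℝ) 1) (hσ : σ ∈ Set.Ioo (0:ℝ) 1) (hδσ : δ ≤ σ)
    (x d : ℕ → H) (α : ℕ → ℝ) (hα : ∀ n, α n ∈ Set.Ioc (0:ℝ) 1)
    (hx : ∀ n, x (n+1) = x n + α n • d n)
    (hA : ∀ n, ‖x (n+1) - T (x (n+1))‖ ^ 2 - ‖x n - T (x n)‖ ^ 2
      ≤ δ * α n * ⟪x n - T (x n), d n⟫)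
    (hW : ∀ n, σ * ⟪x n - T (x n), d n⟫ ≤ ⟪x (n+1) - T (x (n+1)), d n⟫)
    (hd : ∀ n, d n = -(x n - T (x n)))
    (hnz : ∀ n, ‖x n - T (x n)‖ ≠ 0) :
    ∃ p : H, T p = p ∧ ∀ y : H, Tendsto (fun n => ⟪x n, y⟫) atTop (nhds ⟪p, y⟫) := by
  have hα_low : ∀ n, (1 - σ) / 2 ≤ α n := fun n => by
    refine step_size_lower_bound_s3 hT (hα n).1.le ?_ (norm_ne_zero_iff.mp (hnz n))
      (z := x (n + 1)) (x := x n) ?_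
    · rw [hx, hd, smul_neg, ← sub_eq_add_neg]
    · have h := hW n
      rw [hd, inner_neg_right, inner_neg_right, real_inner_self_eq_norm_sq] at h
      linarith
  have hTc : Continuous T := (LipschitzWith.of_dist_le_mul (K := 1) fun a b => by
    simpa [dist_eq_norm] using hT a b).continuous
  have hstep : ∀ n, ‖x n - x (n + 1)‖ ≤ ‖x n - T (x n)‖ := fun n => by
    rw [hx, hd, sub_add_cancel_left, norm_neg, norm_smul, norm_neg,
      Real.norm_of_nonneg (hα n).1.le]
    exact mul_le_of_le_one_left (norm_nonneg _) (hα n).2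
  have hprod : 0 < δ * ((1 - σ) / 2) := mul_pos hδ.1 (by linarith [hσ.2])
  have hq : 0 ≤ 1 - δ * ((1 - σ) / 2) := by nlinarith [hδ.1, hδ.2, hσ.1, hσ.2]
  have hres : ∀ n, ‖x (n + 1) - T (x (n + 1))‖
      ≤ √(1 - δ * ((1 - σ) / 2)) * ‖x n - T (x n)‖ := fun n => by
    refine abs_le_of_sq_le_sq' ?_ (by positivity) |>.2
    rw [mul_pow, Real.sq_sqrt hq]
    have h := hA n
    rw [hd, inner_neg_right, real_inner_self_eq_norm_sq] at h
    have h' := mul_le_mul_of_nonneg_right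
      (mul_le_mul_of_nonneg_left (hα_low n) hδ.1.le) (sq_nonneg ‖x n - T (x n)‖)
    linarith
  obtain ⟨p, hp, hlim⟩ := exists_fixed_point_tendsto_of_geometric_residual hTc (Real.sqrt_nonneg _)
    ((Real.sqrt_lt' one_pos).mpr (by linarith)) hstep hres
  exact ⟨p, hp, fun y => hlim.inner tendsto_const_nhds⟩
end

section
/- Suppose that the Dai–Yuan formula β_n = β_n^DY := ‖x_{n+1} − T(x_{n+1})‖² / ⟨d_n, y_n⟩ is used and that ‖x_n − T(x_n)‖ ≠ 0 for all n ∈ ℕ. Then for all n ∈ ℕ: ⟨x_n − T(x_n), d_n⟩ < 0, ⟨d_n, y_n⟩ > 0, and β_n^DY > 0 (in particular the algorithm is well-defined). -/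
open RealInnerProductSpace Filter

/-- Dai–Yuan direction: descent property, positivity of ⟪d n, y n⟫ and of β n. -/
theorem stmt_4 {H : Type*} [NormedAddCommGroup H] [InnerProductSpace ℝ H] [CompleteSpace H]
    (T : H → H) (hT : ∀ x y : H, ‖T x - T y‖ ≤ ‖x - y‖) (hFix : ∃ p : H, T p = p)
    (δ σ : ℝ) (hδ : δ ∈ Set.Ioo (0:ℝ) 1) (hσ : σ ∈ Set.Ioo (0:ℝ) 1) (hδσ : δ ≤ σ)
    (x d : ℕ → H) (α : ℕ → ℝ) (β : ℕ → ℝ) (hα : ∀ n, α n ∈ Set.Ioc (0:ℝ) 1)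
    (hx : ∀ n, x (n+1) = x n + α n • d n)
    (hA : ∀ n, ‖x (n+1) - T (x (n+1))‖ ^ 2 - ‖x n - T (x n)‖ ^ 2
      ≤ δ * α n * ⟪x n - T (x n), d n⟫)
    (hW : ∀ n, σ * ⟪x n - T (x n), d n⟫ ≤ ⟪x (n+1) - T (x (n+1)), d n⟫)
    (hd0 : d 0 = -(x 0 - T (x 0)))
    (hd : ∀ n, d (n+1) = -(x (n+1) - T (x (n+1))) + β n • d n)
    (hβ : ∀ n, β n = ‖x (n+1) - T (x (n+1))‖ ^ 2
      / ⟪d n, (x (n+1) - T (x (n+1))) - (x n - T (x n))⟫)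
    (hnz : ∀ n, ‖x n - T (x n)‖ ≠ 0) :
    ∀ n : ℕ, ⟪x n - T (x n), d n⟫ < 0
      ∧ 0 < ⟪d n, (x (n+1) - T (x (n+1))) - (x n - T (x n))⟫
      ∧ 0 < β n := by
  have hpos (n : ℕ) : 0 < ‖x n - T (x n)‖ ^ 2 := by
    have := hnz n
    positivity
  have hy (n : ℕ) (hn : ⟪x n - T (x n), d n⟫ < 0) :
      0 < ⟪d n, (x (n+1) - T (x (n+1))) - (x n - T (x n))⟫ := by
    rw [inner_sub_right, real_inner_comm _ (d n), real_inner_comm _ (d n)]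
    nlinarith [hW n, hσ.2]
  have hdesc (n : ℕ) : ⟪x n - T (x n), d n⟫ < 0 := by
    induction n with
    | zero =>
      rw [hd0, inner_neg_right, real_inner_self_eq_norm_sq]
      linarith [hpos 0]
    | succ n ih =>
      have hyn := hy n ih
      have key : ⟪x (n+1) - T (x (n+1)), d (n+1)⟫ = ‖x (n+1) - T (x (n+1))‖ ^ 2
          * ⟪x n - T (x n), d n⟫
          / ⟪d n, (x (n+1) - T (x (n+1))) - (x n - T (x n))⟫ := by
        rw [hd, inner_add_right, inner_neg_right, real_inner_self_eq_norm_sq,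
          real_inner_smul_right, hβ, eq_div_iff hyn.ne', add_mul, mul_right_comm,
          div_mul_cancel₀ _ hyn.ne', inner_sub_right, real_inner_comm _ (d n),
          real_inner_comm _ (d n)]
        ring
      rw [key]
      exact div_neg_of_neg_of_pos (mul_neg_of_pos_of_neg (hpos (n+1)) ih) hyn
  intro n
  have hyn := hy n (hdesc n)
  refine ⟨hdesc n, hyn, ?_⟩
  rw [hβ]
  exact div_pos (hpos (n+1)) hyn
end

section
/- Suppose that the Dai–Yuan formula β_n = β_n^DY := ‖x_{n+1} − T(x_{n+1})‖² / ⟨d_n, y_n⟩ is used and that ‖x_n − T(x_n)‖ ≠ 0 for all n ∈ ℕ. Then for all n ∈ ℕ the identity ⟨d_{n+1}, x_{n+1} − T(x_{n+1})⟩ = β_n^DY ⟨d_n, x_n − T(x_n)⟩ holds, and this quantity is negative. -/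
open RealInnerProductSpace Filter

/-- One Dai–Yuan update: if `d` is a descent direction for the residual `g` and the curvature
condition holds at the new residual `g'`, then so is the updated direction for `g'`. -/
lemma daiYuan_inner_eq_and_neg {H : Type*} [NormedAddCommGroup H] [InnerProductSpace ℝ H]
    {g g' d : H} {σ : ℝ} (hσ : σ < 1) (hg' : ‖g'‖ ≠ 0) (hdesc : ⟪d, g⟫ < 0)
    (hcurv : σ * ⟪g, d⟫ ≤ ⟪g', d⟫) :
    ⟪-g' + (‖g'‖ ^ 2 / ⟪d, g' - g⟫) • d, g'⟫ = ‖g'‖ ^ 2 / ⟪d, g' - g⟫ * ⟪d, g⟫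
      ∧ ⟪-g' + (‖g'‖ ^ 2 / ⟪d, g' - g⟫) • d, g'⟫ < 0 := by
  rw [real_inner_comm, real_inner_comm d g'] at hcurv
  have hpos : 0 < ⟪d, g' - g⟫ := by
    rw [inner_sub_right]
    nlinarith
  have heq : ⟪-g' + (‖g'‖ ^ 2 / ⟪d, g' - g⟫) • d, g'⟫
      = ‖g'‖ ^ 2 / ⟪d, g' - g⟫ * ⟪d, g⟫ := by
    have hmul : ‖g'‖ ^ 2 / ⟪d, g' - g⟫ * ⟪d, g' - g⟫ = ‖g'‖ ^ 2 :=
      div_mul_cancel₀ _ hpos.ne'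
    have hsub : ⟪d, g⟫ = ⟪d, g'⟫ - ⟪d, g' - g⟫ := by
      rw [inner_sub_right]
      ring
    rw [inner_add_left, inner_neg_left, real_inner_smul_left, real_inner_self_eq_norm_sq, hsub,
      mul_sub, hmul]
    ring
  exact ⟨heq, heq ▸ mul_neg_of_pos_of_neg (by positivity) hdesc⟩

/-- Dai–Yuan direction: the identity ⟪d (n+1), x (n+1) − T (x (n+1))⟫ = β n ⟪d n, x n − T (x n)⟫,
and this quantity is negative. -/
theorem stmt_5 {H : Type*} [NormedAddCommGroup H] [InnerProductSpace ℝ H] [CompleteSpace H]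
    (T : H → H) (hT : ∀ x y : H, ‖T x - T y‖ ≤ ‖x - y‖) (hFix : ∃ p : H, T p = p)
    (δ σ : ℝ) (hδ : δ ∈ Set.Ioo (0:ℝ) 1) (hσ : σ ∈ Set.Ioo (0:ℝ) 1) (hδσ : δ ≤ σ)
    (x d : ℕ → H) (α : ℕ → ℝ) (β : ℕ → ℝ) (hα : ∀ n, α n ∈ Set.Ioc (0:ℝ) 1)
    (hx : ∀ n, x (n+1) = x n + α n • d n)
    (hA : ∀ n, ‖x (n+1) - T (x (n+1))‖ ^ 2 - ‖x n - T (x n)‖ ^ 2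
      ≤ δ * α n * ⟪x n - T (x n), d n⟫)
    (hW : ∀ n, σ * ⟪x n - T (x n), d n⟫ ≤ ⟪x (n+1) - T (x (n+1)), d n⟫)
    (hd0 : d 0 = -(x 0 - T (x 0)))
    (hd : ∀ n, d (n+1) = -(x (n+1) - T (x (n+1))) + β n • d n)
    (hβ : ∀ n, β n = ‖x (n+1) - T (x (n+1))‖ ^ 2
      / ⟪d n, (x (n+1) - T (x (n+1))) - (x n - T (x n))⟫)
    (hnz : ∀ n, ‖x n - T (x n)‖ ≠ 0) :
    ∀ n : ℕ, ⟪d (n+1), x (n+1) - T (x (n+1))⟫ = β n * ⟪d n, x n - T (x n)⟫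
      ∧ ⟪d (n+1), x (n+1) - T (x (n+1))⟫ < 0 := by
  have step : ∀ n, ⟪d n, x n - T (x n)⟫ < 0 →
      ⟪d (n+1), x (n+1) - T (x (n+1))⟫ = β n * ⟪d n, x n - T (x n)⟫
        ∧ ⟪d (n+1), x (n+1) - T (x (n+1))⟫ < 0 := by
    intro n hn
    rw [hd n, hβ n]
    exact daiYuan_inner_eq_and_neg hσ.2 (hnz (n+1)) hn (hW n)
  have hdesc : ∀ n, ⟪d n, x n - T (x n)⟫ < 0 := by
    intro n
    induction n with
    | zero =>
      rw [hd0, inner_neg_left, real_inner_self_eq_norm_sq, neg_lt_zero]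
      exact sq_pos_of_ne_zero (hnz 0)
    | succ n ih => exact (step n ih).2
  exact fun n => step n (hdesc n)
end

section
/- Suppose that the Dai–Yuan formula β_n = β_n^DY := ‖x_{n+1} − T(x_{n+1})‖² / ⟨d_n, y_n⟩ is used and that ‖x_n − T(x_n)‖ ≠ 0 for all n ∈ ℕ. Then lim_{n→∞} ‖x_n − T(x_n)‖ = 0. -/
open RealInnerProductSpace Filter

/-- A nonnegative real sequence cannot decrease by at least `c / (n + 1)` at every step. -/
lemma not_forall_le_sub_div_succ {G : ℕ → ℝ} (hG : ∀ n, 0 ≤ G n) {c : ℝ} (hc : 0 < c) :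
    ¬ ∀ n : ℕ, G (n + 1) ≤ G n - c * (1 / ((n : ℝ) + 1)) := by
  intro h
  have hsum : ∀ n : ℕ, c * ∑ i ∈ Finset.range n, (1 / ((i : ℝ) + 1)) ≤ G 0 - G n := by
    intro n
    induction n with
    | zero => simp
    | succ n ih =>
      rw [Finset.sum_range_succ, mul_add]
      linarith [h n]
  obtain ⟨n, hn⟩ := ((Real.tendsto_sum_range_one_div_nat_succ_atTop.const_mul_atTop
    hc).eventually_gt_atTop (G 0)).exists
  linarith [hsum n, hG n]

section DaiYuan

variable {H : Type*} [NormedAddCommGroup H] [InnerProductSpace ℝ H]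

/-- The Dai–Yuan update satisfies `⟪g', d'⟫ = b * ⟪g, d⟫`. -/
lemma inner_daiYuan_eq {g g' d d' : H} {b : ℝ} (hd : d' = -g' + b • d)
    (hb : b = ‖g'‖ ^ 2 / ⟪d, g' - g⟫) (hpos : 0 < ⟪d, g' - g⟫) :
    ⟪g', d'⟫ = b * ⟪g, d⟫ := by
  have hmul : b * ⟪d, g' - g⟫ = ‖g'‖ ^ 2 := by
    rw [hb, div_mul_cancel₀ _ hpos.ne']
  rw [inner_sub_right, real_inner_comm g' d, real_inner_comm g d] at hmul
  rw [hd, inner_add_right, inner_neg_right, real_inner_smul_right, real_inner_self_eq_norm_sq]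
  linarith

/-- Growth of the Dai–Yuan directions relative to the squared directional derivative. -/
lemma daiYuan_norm_sq_step {g g' d d' : H} {b ε k : ℝ} (hd : d' = -g' + b • d)
    (hs : ⟪g', d'⟫ = b * ⟪g, d⟫) (hε : 0 ≤ ε) (hg : ε ≤ ‖g'‖ ^ 2)
    (h : ε * ‖d‖ ^ 2 ≤ k * ⟪g, d⟫ ^ 2) :
    ε * ‖d'‖ ^ 2 ≤ (k + 1) * ⟪g', d'⟫ ^ 2 := by
  have hbd : b ^ 2 * ‖d‖ ^ 2 = ‖d'‖ ^ 2 + 2 * ⟪g', d'⟫ + ‖g'‖ ^ 2 := by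
    have hsum : d' + g' = b • d := by rw [hd]; abel
    have hnorm := norm_add_sq_real d' g'
    rw [hsum, norm_smul, mul_pow, Real.norm_eq_abs, sq_abs, real_inner_comm] at hnorm
    exact hnorm
  have hscaled : ε * (b ^ 2 * ‖d‖ ^ 2) ≤ k * ⟪g', d'⟫ ^ 2 := by
    rw [hs]
    nlinarith [mul_le_mul_of_nonneg_left h (sq_nonneg b)]
  have hrest : ε * (-2 * ⟪g', d'⟫ - ‖g'‖ ^ 2) ≤ ⟪g', d'⟫ ^ 2 := by
    rcases le_total (-2 * ⟪g', d'⟫ - ‖g'‖ ^ 2) 0 with h0 | h0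
    · exact (mul_nonpos_of_nonneg_of_nonpos hε h0).trans (sq_nonneg _)
    · nlinarith [mul_le_mul_of_nonneg_right hg h0, sq_nonneg (⟪g', d'⟫ + ‖g'‖ ^ 2)]
  rw [hbd] at hscaled
  linarith

/-- The curvature condition and `2`-Lipschitz residuals bound the step size from below. -/
lemma neg_inner_le_of_curvature {g g' d : H} {a σ : ℝ} (hW : σ * ⟪g, d⟫ ≤ ⟪g', d⟫)
    (hlip : ‖g' - g‖ ≤ 2 * (a * ‖d‖)) :
    (1 - σ) * -⟪g, d⟫ ≤ 2 * a * ‖d‖ ^ 2 := by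
  have hcs := real_inner_le_norm (g' - g) d
  rw [inner_sub_left] at hcs
  nlinarith [mul_le_mul_of_nonneg_right hlip (norm_nonneg d)]

end DaiYuan

/-- Dai–Yuan direction: lim ‖x n − T (x n)‖ = 0. -/
theorem stmt_7 {H : Type*} [NormedAddCommGroup H] [InnerProductSpace ℝ H] [CompleteSpace H]
    (T : H → H) (hT : ∀ x y : H, ‖T x - T y‖ ≤ ‖x - y‖) (hFix : ∃ p : H, T p = p)
    (δ σ : ℝ) (hδ : δ ∈ Set.Ioo (0:ℝ) 1) (hσ : σ ∈ Set.Ioo (0:ℝ) 1) (hδσ : δ ≤ σ)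
    (x d : ℕ → H) (α : ℕ → ℝ) (β : ℕ → ℝ) (hα : ∀ n, α n ∈ Set.Ioc (0:ℝ) 1)
    (hx : ∀ n, x (n+1) = x n + α n • d n)
    (hA : ∀ n, ‖x (n+1) - T (x (n+1))‖ ^ 2 - ‖x n - T (x n)‖ ^ 2
      ≤ δ * α n * ⟪x n - T (x n), d n⟫)
    (hW : ∀ n, σ * ⟪x n - T (x n), d n⟫ ≤ ⟪x (n+1) - T (x (n+1)), d n⟫)
    (hd0 : d 0 = -(x 0 - T (x 0)))
    (hd : ∀ n, d (n+1) = -(x (n+1) - T (x (n+1))) + β n • d n)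
    (hβ : ∀ n, β n = ‖x (n+1) - T (x (n+1))‖ ^ 2
      / ⟪d n, (x (n+1) - T (x (n+1))) - (x n - T (x n))⟫)
    (hnz : ∀ n, ‖x n - T (x n)‖ ≠ 0) :
    Tendsto (fun n => ‖x n - T (x n)‖) atTop (nhds 0) := by
  obtain ⟨hδ0, -⟩ := hδ
  have hσ1 : 0 < 1 - σ := sub_pos.2 hσ.2
  obtain ⟨g, hg⟩ : ∃ g : ℕ → H, ∀ n, x n - T (x n) = g n := ⟨_, fun _ => rfl⟩
  have hlip : ∀ n, ‖g (n + 1) - g n‖ ≤ 2 * (α n * ‖d n‖) := by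
    intro n
    have hstep : x (n + 1) - x n = α n • d n := by rw [hx n]; abel
    have hnorm : ‖x (n + 1) - x n‖ = α n * ‖d n‖ := by
      rw [hstep, norm_smul, Real.norm_of_nonneg (hα n).1.le]
    have heq : g (n + 1) - g n = (x (n + 1) - x n) - (T (x (n + 1)) - T (x n)) := by
      rw [← hg, ← hg]; abel
    rw [heq]
    linarith [norm_sub_le (x (n + 1) - x n) (T (x (n + 1)) - T (x n)), hT (x (n + 1)) (x n)]
  simp only [hg] at *
  have hcurv : ∀ n, (1 - σ) * -⟪g n, d n⟫ ≤ ⟪d n, g (n + 1) - g n⟫ := by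
    intro n
    rw [inner_sub_right, real_inner_comm (g (n + 1)), real_inner_comm (g n)]
    linarith [hW n]
  have hgpos : ∀ n, 0 < ‖g n‖ ^ 2 := fun n => by have := hnz n; positivity
  have hrec : ∀ n, ⟪g n, d n⟫ < 0 → 0 < ⟪d n, g (n + 1) - g n⟫ := fun n hn =>
    (mul_pos hσ1 (neg_pos.2 hn)).trans_le (hcurv n)
  have hneg : ∀ n, ⟪g n, d n⟫ < 0 := by
    intro n
    induction n with
    | zero =>
      rw [hd0, inner_neg_right, real_inner_self_eq_norm_sq]
      linarith [hgpos 0]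
    | succ n ih =>
      rw [inner_daiYuan_eq (hd n) (hβ n) (hrec n ih)]
      refine mul_neg_of_pos_of_neg ?_ ih
      rw [hβ n]
      exact div_pos (hgpos _) (hrec n ih)
  have hanti : Antitone fun n => ‖g n‖ ^ 2 := by
    refine antitone_nat_of_succ_le fun n => ?_
    have := mul_neg_of_pos_of_neg (mul_pos hδ0 (hα n).1) (hneg n)
    linarith [hA n]
  have hsmall : ∀ ε > 0, ∃ n, ‖g n‖ ^ 2 < ε := by
    intro ε hε
    by_contra! hge
    have hgrowth : ∀ n : ℕ, ε * ‖d n‖ ^ 2 ≤ ((n : ℝ) + 1) * ⟪g n, d n⟫ ^ 2 := by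
      intro n
      induction n with
      | zero =>
        rw [hd0, inner_neg_right, real_inner_self_eq_norm_sq, norm_neg]
        push_cast
        nlinarith [mul_le_mul_of_nonneg_right (hge 0) (hgpos 0).le]
      | succ n ih =>
        push_cast
        exact daiYuan_norm_sq_step (hd n) (inner_daiYuan_eq (hd n) (hβ n) (hrec n (hneg n)))
          hε.le (hge _) ih
    have hc : 0 < δ * ((1 - σ) * ε / 2) := by positivity
    refine not_forall_le_sub_div_succ (fun n => (hgpos n).le) hc fun n => ?_
    have hs := neg_pos.2 (hneg n)
    have hstep := neg_inner_le_of_curvature (hW n) (hlip n)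
    have hn : (0 : ℝ) < n + 1 := by positivity
    have hdec : (1 - σ) * ε / 2 * (1 / ((n : ℝ) + 1)) ≤ α n * -⟪g n, d n⟫ := by
      rw [mul_one_div, div_le_iff₀ hn]
      refine le_of_mul_le_mul_right ?_ hs
      have h1 := mul_le_mul_of_nonneg_left hstep hε.le
      have h2 := mul_le_mul_of_nonneg_left (hgrowth n) (hα n).1.le
      linarith
    linarith [hA n, mul_le_mul_of_nonneg_left hdec hδ0.le]
  rw [Metric.tendsto_atTop]
  intro ε hε
  obtain ⟨N, hN⟩ := hsmall (ε ^ 2) (by positivity)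
  refine ⟨N, fun n hn => ?_⟩
  rw [Real.dist_0_eq_abs, abs_norm]
  exact lt_of_pow_lt_pow_left₀ 2 hε.le ((hanti hn).trans_lt hN)
end

section
/- Suppose that the Fletcher–Reeves formula β_n = β_n^FR := ‖x_{n+1} − T(x_{n+1})‖² / ‖x_n − T(x_n)‖² is used under the strong Wolfe-type conditions with σ ∈ (0,1/2], and that ‖x_n − T(x_n)‖ ≠ 0 for all n ∈ ℕ. Then for all n ∈ ℕ: −∑_{j=0}^n σ^j ≤ ⟨x_n − T(x_n), d_n⟩ / ‖x_n − T(x_n)‖² ≤ −2 + ∑_{j=0}^n σ^j; in particular ⟨x_n − T(x_n), d_n⟩ < 0 for all n ∈ ℕ. -/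
open RealInnerProductSpace Filter

/-- A geometric sum with ratio in `(0, 1/2]` is less than `2`. -/
lemma geom_sum_lt_two {σ : ℝ} (hσ : 0 < σ) (hσhalf : σ ≤ 1 / 2) (n : ℕ) :
    ∑ j ∈ Finset.range n, σ ^ j < 2 := by
  have h := mul_neg_geom_sum σ n
  have hpow : 0 < σ ^ n := pow_pos hσ n
  by_contra! hge
  nlinarith

/-- A sequence starting at `-1` whose next term differs from `-1` by at most `-σ` times the
current one lies between `-S` and `-2 + S`, where `S` is the geometric sum of `σ`. -/
lemma bounds_of_abs_add_one_le {σ : ℝ} (hσ : 0 ≤ σ) {r : ℕ → ℝ} (h0 : r 0 = -1)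
    (hr : ∀ n, |r (n + 1) + 1| ≤ -σ * r n) (n : ℕ) :
    -(∑ j ∈ Finset.range (n + 1), σ ^ j) ≤ r n ∧
      r n ≤ -2 + ∑ j ∈ Finset.range (n + 1), σ ^ j := by
  induction n with
  | zero => norm_num [h0]
  | succ n ih =>
    have hmul := mul_le_mul_of_nonneg_left ih.1 hσ
    have hstep := abs_le.mp (hr n)
    rw [geom_sum_succ]
    constructor <;> linarith [hstep.1, hstep.2]

/-- Fletcher–Reeves direction under the strong Wolfe-type conditions:
the two-sided bound on ⟪x n − T (x n), d n⟫ / ‖x n − T (x n)‖², and negativity. -/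
theorem stmt_8 {H : Type*} [NormedAddCommGroup H] [InnerProductSpace ℝ H] [CompleteSpace H]
    (T : H → H) (hT : ∀ x y : H, ‖T x - T y‖ ≤ ‖x - y‖) (hFix : ∃ p : H, T p = p)
    (δ σ : ℝ) (hδ : δ ∈ Set.Ioo (0:ℝ) 1) (hσ : σ ∈ Set.Ioo (0:ℝ) 1) (hδσ : δ ≤ σ)
    (hσhalf : σ ≤ 1/2)
    (x d : ℕ → H) (α : ℕ → ℝ) (β : ℕ → ℝ) (hα : ∀ n, α n ∈ Set.Ioc (0:ℝ) 1)
    (hx : ∀ n, x (n+1) = x n + α n • d n)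
    (hA : ∀ n, ‖x (n+1) - T (x (n+1))‖ ^ 2 - ‖x n - T (x n)‖ ^ 2
      ≤ δ * α n * ⟪x n - T (x n), d n⟫)
    (hSW : ∀ n, |⟪x (n+1) - T (x (n+1)), d n⟫| ≤ -σ * ⟪x n - T (x n), d n⟫)
    (hd0 : d 0 = -(x 0 - T (x 0)))
    (hd : ∀ n, d (n+1) = -(x (n+1) - T (x (n+1))) + β n • d n)
    (hβ : ∀ n, β n = ‖x (n+1) - T (x (n+1))‖ ^ 2 / ‖x n - T (x n)‖ ^ 2)
    (hnz : ∀ n, ‖x n - T (x n)‖ ≠ 0) :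
    ∀ n : ℕ,
      (-(∑ j ∈ Finset.range (n+1), σ ^ j)
          ≤ ⟪x n - T (x n), d n⟫ / ‖x n - T (x n)‖ ^ 2
        ∧ ⟪x n - T (x n), d n⟫ / ‖x n - T (x n)‖ ^ 2
          ≤ -2 + ∑ j ∈ Finset.range (n+1), σ ^ j)
      ∧ ⟪x n - T (x n), d n⟫ < 0 := by
  have hpos : ∀ n, 0 < ‖x n - T (x n)‖ ^ 2 := fun n => by have := hnz n; positivity
  have h0 : ⟪x 0 - T (x 0), d 0⟫ / ‖x 0 - T (x 0)‖ ^ 2 = -1 := by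
    rw [hd0, inner_neg_right, real_inner_self_eq_norm_sq, neg_div, div_self (hpos 0).ne']
  have hratio : ∀ n, ⟪x (n + 1) - T (x (n + 1)), d (n + 1)⟫ / ‖x (n + 1) - T (x (n + 1))‖ ^ 2 + 1
      = ⟪x (n + 1) - T (x (n + 1)), d n⟫ / ‖x n - T (x n)‖ ^ 2 := fun n => by
    have hn := hnz n
    have hn' := hnz (n + 1)
    rw [hd, inner_add_right, inner_neg_right, real_inner_self_eq_norm_sq, real_inner_smul_right, hβ]
    field_simp
    ring
  intro n
  have hbounds := bounds_of_abs_add_one_le hσ.1.le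
    (r := fun n => ⟪x n - T (x n), d n⟫ / ‖x n - T (x n)‖ ^ 2) h0 (fun n => by
      rw [hratio, abs_div, abs_of_pos (hpos n), ← mul_div_assoc]
      exact div_le_div_of_nonneg_right (hSW n) (hpos n).le) n
  refine ⟨hbounds, ?_⟩
  have hneg : ⟪x n - T (x n), d n⟫ / ‖x n - T (x n)‖ ^ 2 < 0 := by
    linarith [hbounds.2, geom_sum_lt_two hσ.1 hσhalf (n + 1)]
  simpa using (div_lt_iff₀ (hpos n)).mp hneg
end

section
/- Suppose that the Fletcher–Reeves formula β_n = β_n^FR := ‖x_{n+1} − T(x_{n+1})‖² / ‖x_n − T(x_n)‖² is used under the strong Wolfe-type conditions with σ ∈ (0,1/2], and that ‖x_n − T(x_n)‖ ≠ 0 for all n ∈ ℕ. Then liminf_{n→∞} ‖x_n − T(x_n)‖ = 0. -/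
open RealInnerProductSpace Filter

/-- A nonnegative sequence cannot have decrements at least `c * s n ^ 2 / (n + 1)` when consecutive
terms of `s` sum to at least one: the harmonic series diverges. -/
theorem false_of_harmonic_decrease {u s : ℕ → ℝ} {c : ℝ} (hc : 0 < c) (hu : ∀ n, 0 ≤ u n)
    (hs : ∀ n, 1 ≤ s n + s (n + 1))
    (hdec : ∀ n : ℕ, c * s n ^ 2 / (n + 1) ≤ u n - u (n + 1)) : False := by
  have two_step (k : ℕ) : c / 4 * (1 / ((k : ℝ) + 1)) ≤ u (2 * k) - u (2 * (k + 1)) := by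
    have h₁ := hdec (2 * k)
    have h₂ := hdec (2 * k + 1)
    push_cast at h₁ h₂
    have hsq : 1 / 2 ≤ s (2 * k) ^ 2 + s (2 * k + 1) ^ 2 := by
      nlinarith [hs (2 * k), sq_nonneg (s (2 * k) - s (2 * k + 1))]
    have h₃ : c * s (2 * k) ^ 2 / (2 * k + 1 + 1) ≤ c * s (2 * k) ^ 2 / (2 * k + 1) := by
      gcongr
      linarith
    have h₄ : c / 4 * (1 / ((k : ℝ) + 1)) = c * (1 / 2) / (2 * k + 1 + 1) := by
      field_simp
      ring
    have h₅ : c * (1 / 2) / (2 * k + 1 + 1 : ℝ)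
        ≤ c * (s (2 * k) ^ 2 + s (2 * k + 1) ^ 2) / (2 * k + 1 + 1) := by
      gcongr
    rw [mul_add, add_div] at h₅
    rw [show 2 * (k + 1) = 2 * k + 1 + 1 by ring]
    linarith
  have bound (N : ℕ) :
      c / 4 * ∑ k ∈ Finset.range N, (1 / ((k : ℝ) + 1)) ≤ u 0 := by
    rw [Finset.mul_sum]
    refine (Finset.sum_le_sum fun k _ => two_step k).trans ?_
    rw [Finset.sum_range_sub' (fun k => u (2 * k))]
    simpa using hu (2 * N)
  obtain ⟨N, hN⟩ := ((Real.tendsto_sum_range_one_div_nat_succ_atTop.const_mul_atTop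
    (show 0 < c / 4 by positivity)).eventually_gt_atTop (u 0)).exists
  exact (bound N).not_gt hN

/-- If `g` is a residual sequence that is Lipschitz along `x` with constant `2`, the Fletcher–Reeves
method under the strong Wolfe-type conditions drives `g` arbitrarily close to zero. -/
theorem exists_norm_lt_of_fletcherReeves {H : Type*} [NormedAddCommGroup H]
    [InnerProductSpace ℝ H] {x g d : ℕ → H} {α β : ℕ → ℝ} {δ σ : ℝ} (hδ : 0 < δ) (hσ : 0 < σ)
    (hσhalf : σ ≤ 1 / 2) (hα : ∀ n, 0 < α n) (hx : ∀ n, x (n + 1) = x n + α n • d n)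
    (hg : ∀ n, ‖g (n + 1) - g n‖ ≤ 2 * ‖x (n + 1) - x n‖)
    (hA : ∀ n, ‖g (n + 1)‖ ^ 2 - ‖g n‖ ^ 2 ≤ δ * α n * ⟪g n, d n⟫)
    (hSW : ∀ n, |⟪g (n + 1), d n⟫| ≤ -σ * ⟪g n, d n⟫)
    (hd0 : d 0 = -g 0) (hd : ∀ n, d (n + 1) = -g (n + 1) + β n • d n)
    (hβ : ∀ n, β n = ‖g (n + 1)‖ ^ 2 / ‖g n‖ ^ 2) (hnz : ∀ n, ‖g n‖ ≠ 0) {ε : ℝ} (hε : 0 < ε) :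
    ∃ n, ‖g n‖ < ε := by
  by_contra! hge
  have hG (n : ℕ) : 0 < ‖g n‖ ^ 2 := by
    have := hnz n
    positivity
  have hGε (n : ℕ) : ε ^ 2 ≤ ‖g n‖ ^ 2 := by
    have := hge n
    gcongr
  obtain ⟨s, hs⟩ : ∃ s : ℕ → ℝ, ∀ n, ⟪g n, d n⟫ = -(s n * ‖g n‖ ^ 2) :=
    ⟨fun n => -⟪g n, d n⟫ / ‖g n‖ ^ 2, fun n => by have := hnz n; field_simp⟩
  have hSW' (n : ℕ) : |⟪g (n + 1), d n⟫| ≤ σ * s n * ‖g n‖ ^ 2 := by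
    have := hSW n
    rw [hs] at this
    linarith
  have hs_nonneg (n : ℕ) : 0 ≤ s n := by
    have := (abs_nonneg _).trans (hSW' n)
    exact nonneg_of_mul_nonneg_right (nonneg_of_mul_nonneg_left this (hG n)) hσ
  have hs_succ (n : ℕ) : |1 - s (n + 1)| ≤ σ * s n := by
    have h : (1 - s (n + 1)) * ‖g n‖ ^ 2 = ⟪g (n + 1), d n⟫ := by
      have h₁ := hs (n + 1)
      rw [hd, inner_add_right, inner_neg_right, real_inner_self_eq_norm_sq,
        real_inner_smul_right, hβ] at h₁
      have h₂ := hnz n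
      have h₃ := hG (n + 1)
      field_simp at h₁
      refine mul_left_cancel₀ h₃.ne' ?_
      linear_combination -h₁
    have h' := hSW' n
    rw [← h, abs_mul, abs_of_pos (hG n)] at h'
    exact le_of_mul_le_mul_right h' (hG n)
  have hs_le (n : ℕ) : s n ≤ 2 := by
    induction n with
    | zero =>
      have h := hs 0
      rw [hd0, inner_neg_right, real_inner_self_eq_norm_sq] at h
      nlinarith [hG 0]
    | succ n ih =>
      have := (abs_le.mp (hs_succ n)).1
      nlinarith [hs_nonneg n]
  have hs_add (n : ℕ) : 1 ≤ s n + s (n + 1) := by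
    have := (abs_le.mp (hs_succ n)).2
    nlinarith [hs_nonneg n]
  have hD (n : ℕ) : ‖d n‖ ^ 2 ≤ 3 / ε ^ 2 * (n + 1) * (‖g n‖ ^ 2) ^ 2 := by
    have hone (n : ℕ) : ‖g n‖ ^ 2 ≤ 1 / ε ^ 2 * (‖g n‖ ^ 2) ^ 2 := by
      rw [div_mul_eq_mul_div, le_div_iff₀ (by positivity)]
      nlinarith [hGε n, hG n]
    induction n with
    | zero =>
      rw [hd0, norm_neg]
      have hpos : 0 ≤ 1 / ε ^ 2 * (‖g 0‖ ^ 2) ^ 2 := by positivity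
      push_cast
      linear_combination hone 0 + 2 * hpos
    | succ n ih =>
      have hβG : β n * ‖g n‖ ^ 2 = ‖g (n + 1)‖ ^ 2 := by
        rw [hβ]
        exact div_mul_cancel₀ _ (hG n).ne'
      have hβ0 : 0 ≤ β n := by
        rw [hβ]
        positivity
      have hcross : -⟪g (n + 1), d n⟫ ≤ ‖g n‖ ^ 2 := by
        refine (neg_le_abs _).trans ((hSW' n).trans ?_)
        have : σ * s n ≤ 1 := by nlinarith [hs_nonneg n, hs_le n]
        nlinarith [hG n]
      have hexp : ‖d (n + 1)‖ ^ 2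
          = ‖g (n + 1)‖ ^ 2 + 2 * (β n * -⟪g (n + 1), d n⟫) + β n ^ 2 * ‖d n‖ ^ 2 := by
        rw [hd, norm_add_sq_real, norm_neg, inner_neg_left, real_inner_smul_right, norm_smul,
          mul_pow, Real.norm_eq_abs, sq_abs]
        ring
      have h₁ := mul_le_mul_of_nonneg_left hcross hβ0
      have h₂ := mul_le_mul_of_nonneg_left ih (sq_nonneg (β n))
      have h₃ : β n ^ 2 * (3 / ε ^ 2 * (n + 1) * (‖g n‖ ^ 2) ^ 2)
          = 3 / ε ^ 2 * (n + 1) * (‖g (n + 1)‖ ^ 2) ^ 2 := by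
        rw [← hβG]
        ring
      rw [hβG] at h₁
      rw [h₃] at h₂
      rw [hexp]
      push_cast
      linear_combination 2 * h₁ + h₂ + 3 * hone (n + 1)
  have hstep (n : ℕ) : s n * ‖g n‖ ^ 2 ≤ 4 * α n * ‖d n‖ ^ 2 := by
    have h₁ : ⟪g (n + 1) - g n, d n⟫ ≤ 2 * α n * ‖d n‖ ^ 2 := by
      refine (real_inner_le_norm _ _).trans ?_
      have := hg n
      rw [hx, add_sub_cancel_left, norm_smul, Real.norm_of_nonneg (hα n).le] at this
      nlinarith [norm_nonneg (d n)]
    rw [inner_sub_left, hs] at h₁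
    have h₂ := (abs_le.mp (hSW' n)).1
    have h₃ : σ * (s n * ‖g n‖ ^ 2) ≤ 1 / 2 * (s n * ‖g n‖ ^ 2) :=
      mul_le_mul_of_nonneg_right hσhalf (mul_nonneg (hs_nonneg n) (hG n).le)
    linarith
  refine false_of_harmonic_decrease (u := fun n => ‖g n‖ ^ 2) (s := s)
    (c := δ * ε ^ 2 / 12) (by positivity) (fun n => (hG n).le) hs_add fun n => ?_
  have hdec := hA n
  rw [hs] at hdec
  have hα_ge : s n ≤ 12 / ε ^ 2 * (n + 1) * (α n * ‖g n‖ ^ 2) := by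
    refine le_of_mul_le_mul_right ((hstep n).trans ?_) (hG n)
    have := mul_le_mul_of_nonneg_left (hD n) (show 0 ≤ 4 * α n by linarith [hα n])
    linear_combination this
  have hα_mul := mul_le_mul_of_nonneg_left hα_ge (mul_nonneg hδ.le (hs_nonneg n))
  have h₁ : δ * ε ^ 2 / 12 * s n ^ 2 / (n + 1) ≤ δ * α n * (s n * ‖g n‖ ^ 2) := by
    rw [div_le_iff₀ (by positivity)]
    have := mul_le_mul_of_nonneg_left hα_mul (show 0 ≤ ε ^ 2 / 12 by positivity)
    have hcancel : ε ^ 2 / 12 * (12 / ε ^ 2) = 1 := by field_simp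
    linear_combination this + δ * s n * (n + 1) * (α n * ‖g n‖ ^ 2) * hcancel
  linarith

/-- Fletcher–Reeves direction under the strong Wolfe-type conditions:
liminf ‖x n − T (x n)‖ = 0. -/
theorem stmt_9 {H : Type*} [NormedAddCommGroup H] [InnerProductSpace ℝ H] [CompleteSpace H]
    (T : H → H) (hT : ∀ x y : H, ‖T x - T y‖ ≤ ‖x - y‖) (hFix : ∃ p : H, T p = p)
    (δ σ : ℝ) (hδ : δ ∈ Set.Ioo (0:ℝ) 1) (hσ : σ ∈ Set.Ioo (0:ℝ) 1) (hδσ : δ ≤ σ)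
    (hσhalf : σ ≤ 1/2)
    (x d : ℕ → H) (α : ℕ → ℝ) (β : ℕ → ℝ) (hα : ∀ n, α n ∈ Set.Ioc (0:ℝ) 1)
    (hx : ∀ n, x (n+1) = x n + α n • d n)
    (hA : ∀ n, ‖x (n+1) - T (x (n+1))‖ ^ 2 - ‖x n - T (x n)‖ ^ 2
      ≤ δ * α n * ⟪x n - T (x n), d n⟫)
    (hSW : ∀ n, |⟪x (n+1) - T (x (n+1)), d n⟫| ≤ -σ * ⟪x n - T (x n), d n⟫)
    (hd0 : d 0 = -(x 0 - T (x 0)))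
    (hd : ∀ n, d (n+1) = -(x (n+1) - T (x (n+1))) + β n • d n)
    (hβ : ∀ n, β n = ‖x (n+1) - T (x (n+1))‖ ^ 2 / ‖x n - T (x n)‖ ^ 2)
    (hnz : ∀ n, ‖x n - T (x n)‖ ≠ 0) :
    liminf (fun n => ‖x n - T (x n)‖) atTop = 0 := by
  obtain ⟨hδ0, -⟩ := hδ
  obtain ⟨hσ0, -⟩ := hσ
  have hanti : Antitone fun n => ‖x n - T (x n)‖ := by
    refine antitone_nat_of_succ_le fun n => ?_
    have hle : ⟪x n - T (x n), d n⟫ ≤ 0 := by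
      have := (abs_nonneg _).trans (hSW n)
      nlinarith
    have := mul_nonpos_of_nonneg_of_nonpos (mul_nonneg hδ0.le (hα n).1.le) hle
    exact le_of_sq_le_sq (by linarith [hA n]) (norm_nonneg _)
  have hlip (n : ℕ) : ‖x (n + 1) - T (x (n + 1)) - (x n - T (x n))‖ ≤ 2 * ‖x (n + 1) - x n‖ := by
    rw [sub_sub_sub_comm, two_mul]
    exact (norm_sub_le _ _).trans (add_le_add_right (hT _ _) _)
  refine Tendsto.liminf_eq (Metric.tendsto_atTop.mpr fun ε hε => ?_)
  obtain ⟨N, hN⟩ := exists_norm_lt_of_fletcherReeves (g := fun n => x n - T (x n)) hδ0 hσ0 hσhalf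
    (fun n => (hα n).1) hx hlip hA hSW hd0 hd hβ hnz hε
  refine ⟨N, fun n hn => ?_⟩
  rw [dist_zero_right, norm_norm]
  exact (hanti hn).trans_lt hN
end

section
/- Suppose that the Fletcher–Reeves formula β_n = β_n^FR := ‖x_{n+1} − T(x_{n+1})‖² / ‖x_n − T(x_n)‖² is used under the strong Wolfe-type conditions with σ ∈ (0,1/2], and that ‖x_n − T(x_n)‖ ≠ 0 for all n ∈ ℕ. Then lim_{n→∞} ‖x_n − T(x_n)‖ = 0. -/
open RealInnerProductSpace Filter

/-- A nonnegative real sequence cannot decrease by at least a fixed multiple of `1 / (n + 1)`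
at every step. -/
lemma not_forall_harmonic_decrease {h : ℕ → ℝ} (h_nonneg : ∀ n, 0 ≤ h n) {c : ℝ} (hc : 0 < c) :
    ¬ ∀ n : ℕ, c * (1 / ((n : ℝ) + 1)) ≤ h n - h (n + 1) := by
  intro hdec
  have hsum (n : ℕ) : c * ∑ i ∈ Finset.range n, 1 / ((i : ℝ) + 1) ≤ h 0 := by
    rw [Finset.mul_sum]
    calc _ ≤ ∑ i ∈ Finset.range n, (h i - h (i + 1)) := Finset.sum_le_sum fun i _ => hdec i
      _ = h 0 - h n := Finset.sum_range_sub' h n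
      _ ≤ h 0 := by linarith [h_nonneg n]
  have hdiv := Real.tendsto_sum_range_one_div_nat_succ_atTop.const_mul_atTop hc
  obtain ⟨n, hn⟩ := (hdiv.eventually_gt_atTop (h 0)).exists
  exact (hsum n).not_gt hn

section FletcherReeves

variable {H : Type*} [NormedAddCommGroup H] [InnerProductSpace ℝ H]
  {g d : ℕ → H} {α β : ℕ → ℝ} {δ σ : ℝ}

/-- The normalized slope `-⟪g n, d n⟫ / ‖g n‖ ^ 2` of the search directions. -/
noncomputable def slopeRatio (g d : ℕ → H) (n : ℕ) : ℝ := -⟪g n, d n⟫ / ‖g n‖ ^ 2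

lemma slopeRatio_mul (hnz : ∀ n, ‖g n‖ ≠ 0) (n : ℕ) :
    slopeRatio g d n * ‖g n‖ ^ 2 = -⟪g n, d n⟫ :=
  div_mul_cancel₀ _ (pow_ne_zero 2 (hnz n))

lemma slopeRatio_nonneg (hσ : 0 < σ) (hSW : ∀ n, |⟪g (n + 1), d n⟫| ≤ -σ * ⟪g n, d n⟫) (n : ℕ) :
    0 ≤ slopeRatio g d n := by
  refine div_nonneg ?_ (sq_nonneg _)
  have := (abs_nonneg _).trans (hSW n)
  nlinarith

lemma slopeRatio_zero (hd0 : d 0 = -g 0) (hnz : ∀ n, ‖g n‖ ≠ 0) : slopeRatio g d 0 = 1 := by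
  rw [slopeRatio, hd0, inner_neg_right, real_inner_self_eq_norm_sq, neg_neg,
    div_self (pow_ne_zero 2 (hnz 0))]

lemma abs_slopeRatio_succ_sub_one_le (hnz : ∀ n, ‖g n‖ ≠ 0)
    (hSW : ∀ n, |⟪g (n + 1), d n⟫| ≤ -σ * ⟪g n, d n⟫)
    (hd : ∀ n, d (n + 1) = -g (n + 1) + β n • d n)
    (hβ : ∀ n, β n = ‖g (n + 1)‖ ^ 2 / ‖g n‖ ^ 2) (n : ℕ) :
    |slopeRatio g d (n + 1) - 1| ≤ σ * slopeRatio g d n := by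
  have h₀ := hnz n
  have h₁ := hnz (n + 1)
  have heq : slopeRatio g d (n + 1) - 1 = -(⟪g (n + 1), d n⟫ / ‖g n‖ ^ 2) := by
    rw [slopeRatio, hd, inner_add_right, inner_neg_right, real_inner_self_eq_norm_sq,
      real_inner_smul_right, hβ]
    field_simp
    ring
  rw [heq, abs_neg, abs_div, abs_of_nonneg (sq_nonneg ‖g n‖), slopeRatio, ← mul_div_assoc]
  exact div_le_div_of_nonneg_right ((hSW n).trans_eq (by ring)) (sq_nonneg _)

lemma slopeRatio_le_two (hσ : 0 < σ) (hσhalf : σ ≤ 1 / 2) (hnz : ∀ n, ‖g n‖ ≠ 0)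
    (hSW : ∀ n, |⟪g (n + 1), d n⟫| ≤ -σ * ⟪g n, d n⟫) (hd0 : d 0 = -g 0)
    (hd : ∀ n, d (n + 1) = -g (n + 1) + β n • d n)
    (hβ : ∀ n, β n = ‖g (n + 1)‖ ^ 2 / ‖g n‖ ^ 2) (n : ℕ) :
    slopeRatio g d n ≤ 2 := by
  induction n with
  | zero => rw [slopeRatio_zero hd0 hnz]; norm_num
  | succ n ih =>
    have h := (abs_le.mp (abs_slopeRatio_succ_sub_one_le hnz hSW hd hβ n)).2
    have hr := slopeRatio_nonneg hσ hSW n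
    nlinarith

lemma four_fifths_le_slopeRatio_sq_add_sq (hσ : 0 < σ) (hσhalf : σ ≤ 1 / 2)
    (hnz : ∀ n, ‖g n‖ ≠ 0) (hSW : ∀ n, |⟪g (n + 1), d n⟫| ≤ -σ * ⟪g n, d n⟫)
    (hd : ∀ n, d (n + 1) = -g (n + 1) + β n • d n)
    (hβ : ∀ n, β n = ‖g (n + 1)‖ ^ 2 / ‖g n‖ ^ 2) (n : ℕ) :
    4 / 5 ≤ slopeRatio g d n ^ 2 + slopeRatio g d (n + 1) ^ 2 := by
  have h := (abs_le.mp (abs_slopeRatio_succ_sub_one_le hnz hSW hd hβ n)).1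
  have hr := slopeRatio_nonneg hσ hSW n
  have hlin : 1 ≤ slopeRatio g d (n + 1) + slopeRatio g d n / 2 := by nlinarith
  nlinarith [sq_nonneg (slopeRatio g d n - slopeRatio g d (n + 1) / 2)]

/-- Fletcher–Reeves directions grow at most linearly, relative to `‖g n‖ ^ 4`, as long as the
residuals stay away from zero. -/
lemma norm_direction_sq_le (hσ : 0 < σ) (hσhalf : σ ≤ 1 / 2) (hnz : ∀ n, ‖g n‖ ≠ 0)
    (hSW : ∀ n, |⟪g (n + 1), d n⟫| ≤ -σ * ⟪g n, d n⟫) (hd0 : d 0 = -g 0)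
    (hd : ∀ n, d (n + 1) = -g (n + 1) + β n • d n)
    (hβ : ∀ n, β n = ‖g (n + 1)‖ ^ 2 / ‖g n‖ ^ 2) {ε : ℝ} (hε : 0 < ε)
    (hge : ∀ n, ε ≤ ‖g n‖ ^ 2) (n : ℕ) :
    ‖d n‖ ^ 2 ≤ (‖g n‖ ^ 2) ^ 2 * (3 / ε * (n + 1)) := by
  have hgrow (n : ℕ) : ‖g n‖ ^ 2 * 3 ≤ (‖g n‖ ^ 2) ^ 2 * (3 / ε) := by
    have : 3 ≤ ‖g n‖ ^ 2 * (3 / ε) := by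
      rw [mul_div_assoc', le_div_iff₀ hε]; linarith [hge n]
    nlinarith [sq_nonneg ‖g n‖]
  induction n with
  | zero =>
    rw [hd0, norm_neg]
    push_cast
    nlinarith [hgrow 0, sq_nonneg ‖g 0‖]
  | succ n ih =>
    have h₀ : 0 < ‖g n‖ ^ 2 := hε.trans_le (hge n)
    have hβ₀ : 0 ≤ β n := by rw [hβ]; positivity
    have hβf : β n * ‖g n‖ ^ 2 = ‖g (n + 1)‖ ^ 2 := by rw [hβ, div_mul_cancel₀ _ h₀.ne']
    have hexp : ‖d (n + 1)‖ ^ 2 =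
        ‖g (n + 1)‖ ^ 2 + 2 * (β n * -⟪g (n + 1), d n⟫) + β n ^ 2 * ‖d n‖ ^ 2 := by
      rw [hd, norm_add_sq_real, norm_neg, inner_neg_left, real_inner_smul_right, norm_smul,
        mul_pow, Real.norm_eq_abs, sq_abs]
      ring
    have hcross : -⟪g (n + 1), d n⟫ ≤ ‖g n‖ ^ 2 := by
      have h₁ := (neg_le_abs _).trans (hSW n)
      have h₂ := slopeRatio_mul (d := d) hnz n
      have h₃ := slopeRatio_nonneg hσ hSW n
      have h₄ := slopeRatio_le_two hσ hσhalf hnz hSW hd0 hd hβ n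
      have h₅ : σ * slopeRatio g d n ≤ 1 := by nlinarith
      nlinarith
    have hmid := mul_le_mul_of_nonneg_left hcross hβ₀
    have hlast := mul_le_mul_of_nonneg_left ih (sq_nonneg (β n))
    have hlast' : β n ^ 2 * ((‖g n‖ ^ 2) ^ 2 * (3 / ε * (n + 1))) =
        (‖g (n + 1)‖ ^ 2) ^ 2 * (3 / ε * (n + 1)) := by rw [← hβf]; ring
    push_cast
    linarith [hgrow (n + 1)]

/-- Zoutendijk-type decrease of the squared residuals, given a bound on the direction. -/
lemma le_norm_sq_sub_norm_sq_succ (hδ : 0 < δ) (hσ : 0 < σ) (hnz : ∀ n, ‖g n‖ ≠ 0)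
    (hL : ∀ n, ‖g (n + 1) - g n‖ ≤ 2 * (α n * ‖d n‖)) (hα : ∀ n, 0 < α n)
    (hA : ∀ n, ‖g (n + 1)‖ ^ 2 - ‖g n‖ ^ 2 ≤ δ * α n * ⟪g n, d n⟫)
    (hSW : ∀ n, |⟪g (n + 1), d n⟫| ≤ -σ * ⟪g n, d n⟫) {n : ℕ} {M : ℝ} (hM : 0 < M)
    (hbound : ‖d n‖ ^ 2 ≤ (‖g n‖ ^ 2) ^ 2 * M) :
    δ * (1 - σ) / (2 * M) * slopeRatio g d n ^ 2 ≤ ‖g n‖ ^ 2 - ‖g (n + 1)‖ ^ 2 := by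
  have hf : 0 < ‖g n‖ ^ 2 := by have := hnz n; positivity
  have hr := slopeRatio_nonneg hσ hSW n
  have hrf := slopeRatio_mul (d := d) hnz n
  set r := slopeRatio g d n
  have hcurv : (1 - σ) * (r * ‖g n‖ ^ 2) ≤ 2 * α n * ‖d n‖ ^ 2 := by
    have h₁ := (neg_le_abs _).trans (hSW n)
    have h₂ : ⟪g (n + 1) - g n, d n⟫ ≤ 2 * (α n * ‖d n‖) * ‖d n‖ :=
      (real_inner_le_norm _ _).trans (mul_le_mul_of_nonneg_right (hL n) (norm_nonneg _))
    rw [inner_sub_left] at h₂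
    rw [hrf]
    linarith
  have hstep : (1 - σ) * r ≤ 2 * α n * M * ‖g n‖ ^ 2 := by
    refine le_of_mul_le_mul_right ?_ hf
    have := mul_le_mul_of_nonneg_left hbound (mul_nonneg zero_le_two (hα n).le)
    linarith
  have hdec : δ * α n * (r * ‖g n‖ ^ 2) ≤ ‖g n‖ ^ 2 - ‖g (n + 1)‖ ^ 2 := by
    rw [hrf]; linarith [hA n]
  refine le_trans ?_ hdec
  rw [div_mul_eq_mul_div, div_le_iff₀ (by positivity)]
  have := mul_le_mul_of_nonneg_left hstep (mul_nonneg hδ.le hr)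
  linarith

end FletcherReeves

/-- Fletcher–Reeves direction under the strong Wolfe-type conditions:
lim ‖x n − T (x n)‖ = 0. -/
theorem stmt_10 {H : Type*} [NormedAddCommGroup H] [InnerProductSpace ℝ H] [CompleteSpace H]
    (T : H → H) (hT : ∀ x y : H, ‖T x - T y‖ ≤ ‖x - y‖) (hFix : ∃ p : H, T p = p)
    (δ σ : ℝ) (hδ : δ ∈ Set.Ioo (0:ℝ) 1) (hσ : σ ∈ Set.Ioo (0:ℝ) 1) (hδσ : δ ≤ σ)
    (hσhalf : σ ≤ 1/2)
    (x d : ℕ → H) (α : ℕ → ℝ) (β : ℕ → ℝ) (hα : ∀ n, α n ∈ Set.Ioc (0:ℝ) 1)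
    (hx : ∀ n, x (n+1) = x n + α n • d n)
    (hA : ∀ n, ‖x (n+1) - T (x (n+1))‖ ^ 2 - ‖x n - T (x n)‖ ^ 2
      ≤ δ * α n * ⟪x n - T (x n), d n⟫)
    (hSW : ∀ n, |⟪x (n+1) - T (x (n+1)), d n⟫| ≤ -σ * ⟪x n - T (x n), d n⟫)
    (hd0 : d 0 = -(x 0 - T (x 0)))
    (hd : ∀ n, d (n+1) = -(x (n+1) - T (x (n+1))) + β n • d n)
    (hβ : ∀ n, β n = ‖x (n+1) - T (x (n+1))‖ ^ 2 / ‖x n - T (x n)‖ ^ 2)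
    (hnz : ∀ n, ‖x n - T (x n)‖ ≠ 0) :
    Tendsto (fun n => ‖x n - T (x n)‖) atTop (nhds 0) := by
  have hδ₀ := hδ.1
  have hσ₀ := hσ.1
  have hσ₁ : 0 < 1 - σ := by linarith
  set g : ℕ → H := fun n => x n - T (x n) with hg
  have hL (n : ℕ) : ‖g (n + 1) - g n‖ ≤ 2 * (α n * ‖d n‖) := by
    have hstep : ‖x (n + 1) - x n‖ = α n * ‖d n‖ := by
      rw [hx, add_sub_cancel_left, norm_smul, Real.norm_eq_abs, abs_of_pos (hα n).1]
    have hsub : g (n + 1) - g n = (x (n + 1) - x n) - (T (x (n + 1)) - T (x n)) := by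
      simp only [hg]; abel
    rw [hsub, ← hstep]
    linarith [norm_sub_le (x (n + 1) - x n) (T (x (n + 1)) - T (x n)), hT (x (n + 1)) (x n)]
  have hslope (n : ℕ) : ⟪g n, d n⟫ ≤ 0 := by
    have := (abs_nonneg _).trans (hSW n)
    nlinarith
  have hanti : Antitone fun n => ‖g n‖ ^ 2 := antitone_nat_of_succ_le fun n => by
    have := mul_nonneg (mul_nonneg hδ₀.le (hα n).1.le) (neg_nonneg.mpr (hslope n))
    linarith [hA n]
  suffices hsq : Tendsto (fun n => ‖g n‖ ^ 2) atTop (nhds 0) by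
    simpa [Real.sqrt_sq (norm_nonneg _)] using hsq.sqrt
  by_contra hlim
  have hbdd : ∃ ε > 0, ∀ n, ε ≤ ‖g n‖ ^ 2 := by
    by_contra! hsmall
    refine hlim (Metric.tendsto_atTop.mpr fun ε hε => ?_)
    obtain ⟨N, hN⟩ := hsmall ε hε
    refine ⟨N, fun n hn => ?_⟩
    rw [Real.dist_eq, sub_zero, abs_of_nonneg (sq_nonneg _)]
    exact (hanti hn).trans_lt hN
  obtain ⟨ε, hε, hge⟩ := hbdd
  have hdir := norm_direction_sq_le hσ₀ hσhalf hnz hSW hd0 hd hβ hε hge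
  refine not_forall_harmonic_decrease (h := fun n => ‖g n‖ ^ 2 + ‖g (n + 1)‖ ^ 2)
    (c := δ * (1 - σ) * ε / 15) (fun n => by positivity) (by positivity) fun n => ?_
  have hM : 0 < 3 / ε * (2 * ((n : ℝ) + 1)) := by positivity
  have hdec₀ := le_norm_sq_sub_norm_sq_succ hδ₀ hσ₀ hnz hL (fun n => (hα n).1) hA hSW hM
    ((hdir n).trans (by gcongr; linarith [n.cast_nonneg (α := ℝ)]))
  have hdec₁ := le_norm_sq_sub_norm_sq_succ hδ₀ hσ₀ hnz hL (fun n => (hα n).1) hA hSW hM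
    ((hdir (n + 1)).trans (by gcongr; push_cast; linarith [n.cast_nonneg (α := ℝ)]))
  have hr := four_fifths_le_slopeRatio_sq_add_sq hσ₀ hσhalf hnz hSW hd hβ n
  have hc : 0 ≤ δ * (1 - σ) / (2 * (3 / ε * (2 * ((n : ℝ) + 1)))) := by positivity
  have hconst : δ * (1 - σ) * ε / 15 * (1 / ((n : ℝ) + 1)) =
      δ * (1 - σ) / (2 * (3 / ε * (2 * ((n : ℝ) + 1)))) * (4 / 5) := by
    field_simp
    norm_num
  have := mul_le_mul_of_nonneg_left hr hc
  rw [hconst]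
  linarith
end

section
/- Suppose that β_n ≥ 0 for all n ∈ ℕ, that there exists c > 0 such that ⟨x_n − T(x_n), d_n⟩ ≤ −c ‖x_n − T(x_n)‖² for all n ∈ ℕ, and that there exists ε > 0 such that ‖x_n − T(x_n)‖ ≥ ε for all n ∈ ℕ. Then, setting u_n := d_n / ‖d_n‖, the series ∑_{n=0}^∞ ‖u_{n+1} − u_n‖² is finite. -/
open RealInnerProductSpace Filter

/-- For unit vectors `u`, `v` and `η ≥ 0`, the distance from `u` to `v` is at most twice the
distance from `u` to `η • v`. -/
theorem norm_sub_le_two_mul_norm_sub_smul {E : Type*} [NormedAddCommGroup E] [NormedSpace ℝ E]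
    {u v : E} (hu : ‖u‖ = 1) (hv : ‖v‖ = 1) {η : ℝ} (hη : 0 ≤ η) :
    ‖u - v‖ ≤ 2 * ‖u - η • v‖ := by
  have hnorm : ‖η • v‖ = η := by rw [norm_smul, hv, mul_one, Real.norm_of_nonneg hη]
  have hdiff : ‖η • v - v‖ = |η - 1| := by
    rw [show η • v - v = (η - 1) • v by rw [sub_smul, one_smul], norm_smul, hv, mul_one,
      Real.norm_eq_abs]
  have habs : |η - 1| ≤ ‖u - η • v‖ := by
    rw [norm_sub_rev]
    simpa [hnorm, hu] using abs_norm_sub_norm_le (η • v) u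
  have htri := norm_sub_le_norm_sub_add_norm_sub u (η • v) v
  linarith

/-- Normalizing `-g + β • a` with `β ≥ 0` moves the direction of `a` by at most
`2 * ‖g‖ / ‖-g + β • a‖`. -/
theorem norm_normalize_sub_normalize_le {E : Type*} [NormedAddCommGroup E] [NormedSpace ℝ E]
    {a b g : E} {β : ℝ} (ha : a ≠ 0) (hb : b ≠ 0) (hβ : 0 ≤ β) (h : b = -g + β • a) :
    ‖(‖b‖)⁻¹ • b - (‖a‖)⁻¹ • a‖ ≤ 2 * (‖g‖ * (‖b‖)⁻¹) := by
  have ha' : ‖a‖ ≠ 0 := norm_ne_zero_iff.mpr ha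
  have key := norm_sub_le_two_mul_norm_sub_smul (η := ‖b‖⁻¹ * β * ‖a‖)
    (norm_smul_inv_norm (𝕜 := ℝ) hb) (norm_smul_inv_norm (𝕜 := ℝ) ha) (by positivity)
  have hr : (‖b‖)⁻¹ • b - (‖b‖⁻¹ * β * ‖a‖) • (‖a‖)⁻¹ • a = -((‖b‖)⁻¹ • g) := by
    rw [smul_smul, mul_assoc, mul_inv_cancel₀ ha', mul_one, mul_smul, ← smul_sub, ← smul_neg]
    congr 1
    rw [sub_eq_iff_eq_add]
    exact h
  simp only [RCLike.ofReal_real_eq_id, id_eq] at key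
  rwa [hr, norm_neg, norm_smul, norm_inv, norm_norm, mul_comm ‖b‖⁻¹] at key

/-- A nonnegative sequence dominated by the decrements of a nonnegative sequence is summable. -/
theorem summable_of_le_sub_succ {f a : ℕ → ℝ} (hf : ∀ n, 0 ≤ f n) (ha : ∀ n, 0 ≤ a n)
    (h : ∀ n, f n ≤ a n - a (n + 1)) : Summable f := by
  refine summable_of_sum_range_le (c := a 0) hf fun n => ?_
  calc ∑ i ∈ Finset.range n, f i ≤ ∑ i ∈ Finset.range n, (a i - a (i + 1)) :=
        Finset.sum_le_sum fun i _ => h i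
    _ = a 0 - a n := Finset.sum_range_sub' a n
    _ ≤ a 0 := sub_le_self _ (ha n)

/-- If β n ≥ 0, the directions satisfy the sufficient descent condition and
‖x n − T (x n)‖ is bounded below away from 0, then ∑ ‖u (n+1) − u n‖² < ∞
where u n := d n / ‖d n‖. -/
theorem stmt_11 {H : Type*} [NormedAddCommGroup H] [InnerProductSpace ℝ H] [CompleteSpace H]
    (T : H → H) (hT : ∀ x y : H, ‖T x - T y‖ ≤ ‖x - y‖) (hFix : ∃ p : H, T p = p)
    (δ σ : ℝ) (hδ : δ ∈ Set.Ioo (0:ℝ) 1) (hσ : σ ∈ Set.Ioo (0:ℝ) 1) (hδσ : δ ≤ σ)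
    (x d : ℕ → H) (α : ℕ → ℝ) (β : ℕ → ℝ) (hα : ∀ n, α n ∈ Set.Ioc (0:ℝ) 1)
    (hx : ∀ n, x (n+1) = x n + α n • d n)
    (hA : ∀ n, ‖x (n+1) - T (x (n+1))‖ ^ 2 - ‖x n - T (x n)‖ ^ 2
      ≤ δ * α n * ⟪x n - T (x n), d n⟫)
    (hW : ∀ n, σ * ⟪x n - T (x n), d n⟫ ≤ ⟪x (n+1) - T (x (n+1)), d n⟫)
    (hd0 : d 0 = -(x 0 - T (x 0)))
    (hd : ∀ n, d (n+1) = -(x (n+1) - T (x (n+1))) + β n • d n)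
    (hβpos : ∀ n, 0 ≤ β n)
    (c : ℝ) (hc : 0 < c)
    (hdesc : ∀ n, ⟪x n - T (x n), d n⟫ ≤ -c * ‖x n - T (x n)‖ ^ 2)
    (ε : ℝ) (hε : 0 < ε) (hbelow : ∀ n, ε ≤ ‖x n - T (x n)‖) :
    Summable (fun n => ‖(‖d (n+1)‖)⁻¹ • d (n+1) - (‖d n‖)⁻¹ • d n‖ ^ 2) := by
  set g : ℕ → H := fun n => x n - T (x n) with hg
  have hp : ∀ n, c * ε ^ 2 ≤ -⟪g n, d n⟫ := fun n => by
    have h1 : ⟪g n, d n⟫ ≤ -c * ‖g n‖ ^ 2 := hdesc n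
    have h2 : c * ε ^ 2 ≤ c * ‖g n‖ ^ 2 := by
      have := hbelow n
      gcongr
    linarith
  have hcε : 0 < c * ε ^ 2 := by positivity
  have hd_ne : ∀ n, d n ≠ 0 := fun n h => by
    have := hp n
    rw [h, inner_zero_right] at this
    linarith
  have hd_pos : ∀ n, 0 < ‖d n‖ := fun n => norm_pos_iff.mpr (hd_ne n)
  have hstep : ∀ n, (1 - σ) * (c * ε ^ 2) ≤ 2 * α n * ‖d n‖ ^ 2 := fun n => by
    have hxd : ‖x (n + 1) - x n‖ = α n * ‖d n‖ := by
      rw [hx n, add_sub_cancel_left, norm_smul, Real.norm_of_nonneg (hα n).1.le]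
    have hlip : ‖g (n + 1) - g n‖ ≤ 2 * (α n * ‖d n‖) := by
      have h1 : g (n + 1) - g n = (x (n + 1) - x n) - (T (x (n + 1)) - T (x n)) := by
        simp only [hg]
        abel
      have h2 := norm_sub_le (x (n + 1) - x n) (T (x (n + 1)) - T (x n))
      have h3 := hT (x (n + 1)) (x n)
      rw [h1]
      linarith
    have hcs : ⟪g (n + 1) - g n, d n⟫ ≤ 2 * (α n * ‖d n‖) * ‖d n‖ :=
      (real_inner_le_norm _ _).trans (by gcongr)
    rw [inner_sub_left] at hcs
    have hw : σ * ⟪g n, d n⟫ ≤ ⟪g (n + 1), d n⟫ := hW n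
    have hσp := mul_le_mul_of_nonneg_left (hp n) (sub_nonneg.mpr hσ.2.le)
    linarith
  have hdec : ∀ n, δ * α n * (c * ε ^ 2) ≤ ‖g n‖ ^ 2 - ‖g (n + 1)‖ ^ 2 := fun n => by
    have h1 : ‖g (n + 1)‖ ^ 2 - ‖g n‖ ^ 2 ≤ δ * α n * ⟪g n, d n⟫ := hA n
    have h2 := mul_le_mul_of_nonneg_left (hp n) (mul_pos hδ.1 (hα n).1).le
    linarith
  have hα_sum : Summable fun n => δ * α n * (c * ε ^ 2) :=
    summable_of_le_sub_succ
      (fun n => mul_nonneg (mul_pos hδ.1 (hα n).1).le hcε.le)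
      (fun n => sq_nonneg ‖g n‖) hdec
  have hg_le : ∀ n, ‖g n‖ ^ 2 ≤ ‖g 0‖ ^ 2 := fun n =>
    antitone_nat_of_succ_le (f := fun n => ‖g n‖ ^ 2)
      (fun n => sub_nonneg.mp
        ((mul_nonneg (mul_pos hδ.1 (hα n).1).le hcε.le).trans (hdec n))) (Nat.zero_le n)
  have hσ' : 0 < 1 - σ := sub_pos.mpr hσ.2
  have hδ' := hδ.1
  have hd_sum : Summable fun n => (‖d n‖⁻¹) ^ 2 := by
    refine Summable.of_nonneg_of_le (fun n => by positivity) (fun n => ?_)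
      (hα_sum.mul_left (2 / (δ * (1 - σ) * (c * ε ^ 2) ^ 2)))
    have hdn := hd_pos n
    rw [inv_pow, inv_le_iff_one_le_mul₀ (by positivity)]
    have : 2 / (δ * (1 - σ) * (c * ε ^ 2) ^ 2) * (δ * α n * (c * ε ^ 2)) * ‖d n‖ ^ 2
        = 2 * α n * ‖d n‖ ^ 2 / ((1 - σ) * (c * ε ^ 2)) := by
      field_simp
    rw [this, one_le_div (by positivity)]
    exact hstep n
  refine Summable.of_nonneg_of_le (fun n => by positivity) (fun n => ?_)
    (((summable_nat_add_iff 1).mpr hd_sum).mul_left (4 * ‖g 0‖ ^ 2))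
  have hu := norm_normalize_sub_normalize_le (hd_ne n) (hd_ne (n + 1)) (hβpos n) (hd n)
  calc ‖(‖d (n+1)‖)⁻¹ • d (n+1) - (‖d n‖)⁻¹ • d n‖ ^ 2
      ≤ (2 * (‖g (n + 1)‖ * ‖d (n + 1)‖⁻¹)) ^ 2 := by gcongr
    _ = 4 * ‖g (n + 1)‖ ^ 2 * (‖d (n + 1)‖⁻¹) ^ 2 := by ring
    _ ≤ 4 * ‖g 0‖ ^ 2 * (‖d (n + 1)‖⁻¹) ^ 2 := by
      gcongr 4 * ?_ * _
      exact hg_le (n + 1)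
end

section
/- Suppose that there exist c > 0 and γ, γ̄ > 0 such that ⟨x_n − T(x_n), d_n⟩ ≤ −c ‖x_n − T(x_n)‖² and γ ≤ ‖x_n − T(x_n)‖ ≤ γ̄ for all n ∈ ℕ, and that there exist b > 1 and λ > 0 such that |β_n| ≤ b for all n ∈ ℕ and, whenever ‖x_{n+1} − x_n‖ ≤ λ, one has |β_n| ≤ 1/(2b) (Property (⋆)). Then for every positive integer Δ and every index k₀ ∈ ℕ there exists k ≥ k₀ such that the number of indices i with k ≤ i ≤ k + Δ − 1 and ‖x_i − x_{i−1}‖ > λ is strictly greater than Δ/2. -/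
open RealInnerProductSpace Filter

/-- A sequence that is, up to an additive constant, multiplied by at most `B` at the
marked indices and by at most `B⁻¹` at the others. -/
lemma growth_le_of_marked_steps {D : ℕ → ℝ} {A B : ℝ} (p : ℕ → Prop) [DecidablePred p]
    (hA : 0 ≤ A) (hB : 1 ≤ B)
    (hlong : ∀ n, D (n + 1) ≤ A + B * D n)
    (hshort : ∀ n, ¬ p (n + 1) → D (n + 1) ≤ A + B⁻¹ * D n) (k m : ℕ) :
    D (k + m) ≤ A * m * B ^ m +
      B ^ (2 * ((Finset.Icc (k + 1) (k + m)).filter p).card) / B ^ m * D k := by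
  have hB0 : 0 < B := by linarith
  induction m with
  | zero => simp
  | succ m ih =>
    have hIcc : Finset.Icc (k + 1) (k + (m + 1))
        = insert (k + m + 1) (Finset.Icc (k + 1) (k + m)) := by
      ext i
      simp only [Finset.mem_Icc, Finset.mem_insert]
      omega
    have hnot : k + m + 1 ∉ (Finset.Icc (k + 1) (k + m)).filter p := by
      simp
    rw [hIcc, Finset.filter_insert, ← add_assoc]
    set q := ((Finset.Icc (k + 1) (k + m)).filter p).card with hq
    have hpow : 1 ≤ B ^ (m + 1) := one_le_pow₀ hB
    have hconst : A + B * (A * m * B ^ m) ≤ A * (m + 1 : ℕ) * B ^ (m + 1) := by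
      have := mul_le_mul_of_nonneg_left hpow hA
      push_cast
      calc A + B * (A * m * B ^ m) = A * 1 + A * m * B ^ (m + 1) := by ring
        _ ≤ A * B ^ (m + 1) + A * m * B ^ (m + 1) := by gcongr
        _ = _ := by ring
    split_ifs with h
    · rw [Finset.card_insert_of_notMem hnot, ← hq]
      calc D (k + m + 1) ≤ A + B * D (k + m) := hlong _
        _ ≤ A + B * (A * m * B ^ m + B ^ (2 * q) / B ^ m * D k) := by gcongr
        _ = (A + B * (A * m * B ^ m)) + B ^ (2 * (q + 1)) / B ^ (m + 1) * D k := by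
          field_simp
          ring
        _ ≤ _ := by gcongr
    · have hinv : B⁻¹ ≤ B := (inv_le_one_of_one_le₀ hB).trans hB
      calc D (k + m + 1) ≤ A + B⁻¹ * D (k + m) := hshort _ h
        _ ≤ A + B⁻¹ * (A * m * B ^ m + B ^ (2 * q) / B ^ m * D k) := by gcongr
        _ = (A + B⁻¹ * (A * m * B ^ m)) + B ^ (2 * q) / B ^ (m + 1) * D k := by
          field_simp
          ring
        _ ≤ (A + B * (A * m * B ^ m)) + B ^ (2 * q) / B ^ (m + 1) * D k := by gcongr
        _ ≤ _ := by gcongr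

/-- A sequence whose decrements dominate the reciprocals of a positive sequence with at most
linear growth is not bounded below by zero. -/
lemma exists_neg_of_sub_inv_linear {u D : ℕ → ℝ} {K M : ℝ} (hK : 0 < K) (hM : 0 ≤ M)
    (hD : ∀ n, 0 < D n) (hgrow : ∀ n, D (n + 1) ≤ D n + M)
    (hu : ∀ n, u (n + 1) ≤ u n - K / D n) : ∃ n, u n < 0 := by
  have hlin : ∀ n : ℕ, D n ≤ (D 0 + M) * (n + 1) := by
    intro n
    have h0 := hD 0
    induction n with
    | zero => simpa using hM
    | succ n ih =>
      push_cast
      nlinarith [hgrow n]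
  set L := K / (D 0 + M) with hL
  have hD0 := hD 0
  have hLpos : 0 < L := by positivity
  have hsum : ∀ n, u n ≤ u 0 - L * ∑ i ∈ Finset.range n, (1 / ((i : ℝ) + 1)) := by
    intro n
    induction n with
    | zero => simp
    | succ n ih =>
      rw [Finset.sum_range_succ, mul_add]
      have : L * (1 / ((n : ℝ) + 1)) ≤ K / D n := by
        rw [hL, div_mul_div_comm, mul_one]
        exact div_le_div_of_nonneg_left hK.le (hD n) (hlin n)
      linarith [hu n]
  obtain ⟨n, hn⟩ :=
    (Real.tendsto_sum_range_one_div_nat_succ_atTop.eventually_gt_atTop (u 0 / L)).exists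
  refine ⟨n, (hsum n).trans_lt ?_⟩
  rw [div_lt_iff₀ hLpos] at hn
  linarith

/-- Zoutendijk-type decrease of the squared residual for one Wolfe step. -/
lemma residual_sq_decrease {H : Type*} [NormedAddCommGroup H] [InnerProductSpace ℝ H]
    {r r' d : H} {α δ σ g : ℝ} (hδ : 0 ≤ δ) (hσ : σ ≤ 1) (hg : 0 ≤ g)
    (hd : 0 < ‖d‖ ^ 2) (hLip : ‖r' - r‖ ≤ 2 * (α * ‖d‖))
    (hA : ‖r'‖ ^ 2 - ‖r‖ ^ 2 ≤ δ * α * ⟪r, d⟫) (hW : σ * ⟪r, d⟫ ≤ ⟪r', d⟫)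
    (hdesc : ⟪r, d⟫ ≤ -g) :
    ‖r'‖ ^ 2 ≤ ‖r‖ ^ 2 - δ * ((1 - σ) / 2 * g ^ 2) / ‖d‖ ^ 2 := by
  have h1 : ⟪r' - r, d⟫ ≤ 2 * α * ‖d‖ ^ 2 := by
    calc ⟪r' - r, d⟫ ≤ ‖r' - r‖ * ‖d‖ := real_inner_le_norm _ _
      _ ≤ 2 * (α * ‖d‖) * ‖d‖ := by gcongr
      _ = _ := by ring
  rw [inner_sub_left] at h1
  have h2 : (1 - σ) / 2 * g ≤ α * ‖d‖ ^ 2 := by nlinarith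
  have hα : 0 ≤ α := by
    have : 0 ≤ (1 - σ) / 2 * g := mul_nonneg (by linarith) hg
    exact nonneg_of_mul_nonneg_left (this.trans h2) hd
  have h3 : δ * ((1 - σ) / 2 * g ^ 2) / ‖d‖ ^ 2 ≤ δ * α * g := by
    rw [div_le_iff₀ hd]
    calc δ * ((1 - σ) / 2 * g ^ 2) = δ * (((1 - σ) / 2 * g) * g) := by ring
      _ ≤ δ * ((α * ‖d‖ ^ 2) * g) := by gcongr
      _ = _ := by ring
  have h4 : δ * α * ⟪r, d⟫ ≤ δ * α * -g := by gcongr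
  linarith

/-- Squared norm of a conjugate-gradient type direction. -/
lemma norm_neg_add_smul_sq_le {H : Type*} [NormedAddCommGroup H] [InnerProductSpace ℝ H]
    {r d : H} {β R b : ℝ} (hr : ‖r‖ ≤ R) (hβ : |β| ≤ b) :
    ‖-r + β • d‖ ^ 2 ≤ 2 * R ^ 2 + 2 * b ^ 2 * ‖d‖ ^ 2 := by
  have h : ‖-r + β • d‖ ≤ R + b * ‖d‖ := by
    refine (norm_add_le _ _).trans ?_
    rw [norm_neg, norm_smul, Real.norm_eq_abs]
    gcongr
  calc ‖-r + β • d‖ ^ 2 ≤ (R + b * ‖d‖) ^ 2 := by gcongr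
    _ ≤ _ := by nlinarith [sq_nonneg (R - b * ‖d‖)]

/-- Under the sufficient descent condition, two-sided bounds on ‖x n − T (x n)‖,
and Property (⋆), for every positive Δ and every k₀ there is k ≥ k₀ such that
more than Δ/2 of the steps with index in [k, k + Δ − 1] are longer than λ. -/
theorem stmt_12 {H : Type*} [NormedAddCommGroup H] [InnerProductSpace ℝ H] [CompleteSpace H]
    (T : H → H) (hT : ∀ x y : H, ‖T x - T y‖ ≤ ‖x - y‖) (hFix : ∃ p : H, T p = p)
    (δ σ : ℝ) (hδ : δ ∈ Set.Ioo (0:ℝ) 1) (hσ : σ ∈ Set.Ioo (0:ℝ) 1) (hδσ : δ ≤ σ)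
    (x d : ℕ → H) (α : ℕ → ℝ) (β : ℕ → ℝ) (hα : ∀ n, α n ∈ Set.Ioc (0:ℝ) 1)
    (hx : ∀ n, x (n+1) = x n + α n • d n)
    (hA : ∀ n, ‖x (n+1) - T (x (n+1))‖ ^ 2 - ‖x n - T (x n)‖ ^ 2
      ≤ δ * α n * ⟪x n - T (x n), d n⟫)
    (hW : ∀ n, σ * ⟪x n - T (x n), d n⟫ ≤ ⟪x (n+1) - T (x (n+1)), d n⟫)
    (hd0 : d 0 = -(x 0 - T (x 0)))
    (hd : ∀ n, d (n+1) = -(x (n+1) - T (x (n+1))) + β n • d n)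
    (c : ℝ) (hc : 0 < c)
    (hdesc : ∀ n, ⟪x n - T (x n), d n⟫ ≤ -c * ‖x n - T (x n)‖ ^ 2)
    (γ γbar : ℝ) (hγ : 0 < γ) (hγbar : 0 < γbar)
    (hbound : ∀ n, γ ≤ ‖x n - T (x n)‖ ∧ ‖x n - T (x n)‖ ≤ γbar)
    (b lam : ℝ) (hb : 1 < b) (hlam : 0 < lam)
    (hβb : ∀ n, |β n| ≤ b)
    (hβlam : ∀ n, ‖x (n+1) - x n‖ ≤ lam → |β n| ≤ 1 / (2 * b)) :
    ∀ Δ : ℕ, 0 < Δ → ∀ k₀ : ℕ, ∃ k ≥ k₀,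
      (Δ : ℝ) / 2 <
        (((Finset.Icc k (k + Δ - 1)).filter (fun i => lam < ‖x i - x (i - 1)‖)).card : ℝ) := by
  intro Δ hΔ k₀
  by_contra! hcon
  have hdpos : ∀ n, 0 < ‖d n‖ ^ 2 := by
    intro n
    have hne : d n ≠ 0 := by
      intro h
      have h1 := hdesc n
      have h2 := pow_pos (hγ.trans_le (hbound n).1) 2
      rw [h, inner_zero_right] at h1
      nlinarith
    positivity
  have hdec : ∀ n, ‖x (n + 1) - T (x (n + 1))‖ ^ 2 ≤
      ‖x n - T (x n)‖ ^ 2 - δ * ((1 - σ) / 2 * (c * γ ^ 2) ^ 2) / ‖d n‖ ^ 2 := by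
    intro n
    refine residual_sq_decrease hδ.1.le hσ.2.le (by positivity) (hdpos n) ?_ (hA n) (hW n) ?_
    · have hstep : ‖x (n + 1) - x n‖ = α n * ‖d n‖ := by
        rw [hx n, add_sub_cancel_left, norm_smul, Real.norm_of_nonneg (hα n).1.le]
      calc ‖x (n + 1) - T (x (n + 1)) - (x n - T (x n))‖
          = ‖(x (n + 1) - x n) - (T (x (n + 1)) - T (x n))‖ := by congr 1; abel
        _ ≤ ‖x (n + 1) - x n‖ + ‖T (x (n + 1)) - T (x n)‖ := norm_sub_le _ _
        _ ≤ 2 * (α n * ‖d n‖) := by linarith [hT (x (n + 1)) (x n)]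
    · have : c * γ ^ 2 ≤ c * ‖x n - T (x n)‖ ^ 2 := by
        have := (hbound n).1
        gcongr
      linarith [hdesc n]
  have hK : 0 < δ * ((1 - σ) / 2 * (c * γ ^ 2) ^ 2) := by
    have h1 : 0 < 1 - σ := sub_pos.2 hσ.2
    have h2 := hδ.1
    positivity
  set K := δ * ((1 - σ) / 2 * (c * γ ^ 2) ^ 2)
  have hanti : Antitone fun n => ‖x n - T (x n)‖ ^ 2 :=
    antitone_nat_of_succ_le fun n =>
      (hdec n).trans (sub_le_self _ (div_nonneg hK.le (hdpos n).le))
  have hB : 1 ≤ 2 * b ^ 2 := by nlinarith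
  have hwindow : ∀ k ≥ k₀, ‖d (k + Δ)‖ ^ 2 ≤
      ‖d k‖ ^ 2 + 2 * γbar ^ 2 * Δ * (2 * b ^ 2) ^ Δ := by
    intro k hk
    have hmain := growth_le_of_marked_steps (D := fun n => ‖d n‖ ^ 2) (A := 2 * γbar ^ 2)
      (B := 2 * b ^ 2) (fun i => lam < ‖x i - x (i - 1)‖)
      (by positivity) hB
      (fun n => by
        rw [hd n]
        exact norm_neg_add_smul_sq_le (hbound (n + 1)).2 (hβb n))
      (fun n hn => by
        have h := norm_neg_add_smul_sq_le (d := d n) (hbound (n + 1)).2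
          (hβlam n (by simpa using hn))
        rw [← hd n] at h
        have hb2 : 2 * (1 / (2 * b)) ^ 2 = (2 * b ^ 2)⁻¹ := by
          field_simp
        rwa [hb2] at h) k Δ
    have hcard := hcon (k + 1) (by omega)
    rw [show k + 1 + Δ - 1 = k + Δ by omega] at hcard
    set q := ((Finset.Icc (k + 1) (k + Δ)).filter (fun i => lam < ‖x i - x (i - 1)‖)).card
    have hq : 2 * q ≤ Δ := by
      have : (2 * q : ℝ) ≤ Δ := by linarith
      exact_mod_cast this
    have hratio : (2 * b ^ 2) ^ (2 * q) / (2 * b ^ 2) ^ Δ ≤ 1 :=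
      div_le_one_of_le₀ (pow_le_pow_right₀ hB hq) (by positivity)
    have := mul_le_mul_of_nonneg_right hratio (hdpos k).le
    linarith
  obtain ⟨n, hn⟩ := exists_neg_of_sub_inv_linear
    (u := fun j => ‖x (k₀ + j * Δ) - T (x (k₀ + j * Δ))‖ ^ 2)
    (D := fun j => ‖d (k₀ + j * Δ)‖ ^ 2) (M := 2 * γbar ^ 2 * Δ * (2 * b ^ 2) ^ Δ)
    hK (by positivity) (fun j => hdpos _)
    (fun j => by
      rw [show k₀ + (j + 1) * Δ = k₀ + j * Δ + Δ by ring]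
      exact hwindow _ (Nat.le_add_right _ _))
    (fun j => by
      refine le_trans (hanti ?_) (hdec (k₀ + j * Δ))
      rw [show k₀ + (j + 1) * Δ = k₀ + j * Δ + Δ by ring]
      omega)
  exact absurd hn (not_lt.2 (sq_nonneg _))
end

section
/- Suppose that β_n ≥ 0 for all n ∈ ℕ, that there exists c > 0 such that ⟨x_n − T(x_n), d_n⟩ ≤ −c ‖x_n − T(x_n)‖² for all n ∈ ℕ, that (x_n)_{n∈ℕ} is bounded, and that Property (⋆) holds, i.e., whenever there exist γ, γ̄ > 0 with γ ≤ ‖x_n − T(x_n)‖ ≤ γ̄ for all n ∈ ℕ, there exist b > 1 and λ > 0 such that |β_n| ≤ b for all n ∈ ℕ and, whenever ‖x_{n+1} − x_n‖ ≤ λ, one has |β_n| ≤ 1/(2b). Then liminf_{n→∞} ‖x_n − T(x_n)‖ = 0. -/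
open RealInnerProductSpace Filter

/-- If `p = -g + t • q` with `t ≥ 0`, the normalizations of `p` and `q` differ by at most
`2 * ‖g‖ / ‖p‖`. -/
lemma norm_normalize_sub_normalize_le_s13 {H : Type*} [NormedAddCommGroup H] [InnerProductSpace ℝ H]
    {p q g : H} {t : ℝ} (ht : 0 ≤ t) (hp : p = -g + t • q) (hp0 : p ≠ 0) (hq0 : q ≠ 0) :
    ‖‖p‖⁻¹ • p - ‖q‖⁻¹ • q‖ ≤ 2 * ‖g‖ / ‖p‖ := by
  have hpn : 0 < ‖p‖ := norm_pos_iff.mpr hp0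
  have hqn : 0 < ‖q‖ := norm_pos_iff.mpr hq0
  have hu : ‖‖q‖⁻¹ • q‖ = 1 := by
    rw [norm_smul, norm_inv, norm_norm, inv_mul_cancel₀ hqn.ne']
  have hdiff : ‖t • q - p‖ = ‖g‖ := by rw [hp]; congr 1; abel
  have habs : |t * ‖q‖ - ‖p‖| ≤ ‖g‖ := by
    have := abs_norm_sub_norm_le (t • q) p
    rwa [hdiff, norm_smul, Real.norm_of_nonneg ht] at this
  have key : ‖p‖⁻¹ • p - ‖q‖⁻¹ • q
      = ‖p‖⁻¹ • ((p - t • q) + (t * ‖q‖ - ‖p‖) • (‖q‖⁻¹ • q)) := by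
    have h1 : (t * ‖q‖ - ‖p‖) • (‖q‖⁻¹ • q) = t • q - ‖p‖ • (‖q‖⁻¹ • q) := by
      rw [sub_smul, mul_smul, smul_smul ‖q‖, mul_inv_cancel₀ hqn.ne', one_smul]
    rw [h1, sub_add_sub_cancel, smul_sub, smul_smul ‖p‖⁻¹ ‖p‖, inv_mul_cancel₀ hpn.ne', one_smul]
  rw [key, norm_smul, norm_inv, norm_norm, div_eq_inv_mul]
  gcongr
  calc _ ≤ ‖p - t • q‖ + ‖(t * ‖q‖ - ‖p‖) • (‖q‖⁻¹ • q)‖ := norm_add_le _ _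
    _ = ‖g‖ + |t * ‖q‖ - ‖p‖| := by
      rw [norm_sub_rev, hdiff, norm_smul, hu, Real.norm_eq_abs, mul_one]
    _ ≤ 2 * ‖g‖ := by linarith

/-- If the directions of the steps all lie within `1 / 2` of one unit vector, the total length
of the steps is at most twice the displacement. -/
lemma sum_norm_le_two_mul_norm_sum {H ι : Type*} [NormedAddCommGroup H] [InnerProductSpace ℝ H]
    (F : Finset ι) (s u : ι → H) (e : H) (he : ‖e‖ = 1) (hs : ∀ i ∈ F, s i = ‖s i‖ • u i)
    (hu : ∀ i ∈ F, ‖u i - e‖ ≤ 1 / 2) :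
    ∑ i ∈ F, ‖s i‖ ≤ 2 * ‖∑ i ∈ F, s i‖ := by
  have h1 : ∀ i ∈ F, ‖s i‖ * (1 / 2) ≤ ⟪s i, e⟫ := by
    intro i hi
    have h2 : ⟪s i, e⟫ = ‖s i‖ * ⟪u i, e⟫ := by
      conv_lhs => rw [hs i hi]
      rw [real_inner_smul_left]
    have h3 : |⟪u i - e, e⟫| ≤ ‖u i - e‖ * ‖e‖ := abs_real_inner_le_norm _ _
    rw [inner_sub_left, real_inner_self_eq_norm_sq, he] at h3
    have h4 := (abs_le.mp h3).1
    rw [h2]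
    gcongr
    linarith [hu i hi]
  have h5 := Finset.sum_le_sum h1
  rw [← Finset.sum_mul, ← sum_inner] at h5
  have h6 := real_inner_le_norm (∑ i ∈ F, s i) e
  rw [he] at h6
  linarith

/-- A discrete Grönwall bound: if `v (i + 1) ≤ G + β i * v i`, where `β i ≤ b` in general and
`β i ≤ 1 / (2 * b)` at every index with `s i ≤ l`, then `v` is damped geometrically, up to the
exponential of the sum of the `s i`. -/
lemma le_add_mul_exp_sum_of_damped {v β s : ℕ → ℝ} {G b l : ℝ} (hG : 0 ≤ G) (hb : 1 < b)
    (hl : 0 < l) (hv : ∀ i, 0 ≤ v i) (hs : ∀ i, 0 ≤ s i)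
    (hrec : ∀ i, v (i + 1) ≤ G + β i * v i) (hβ0 : ∀ i, 0 ≤ β i) (hβ : ∀ i, β i ≤ b)
    (hβs : ∀ i, s i ≤ l → β i ≤ 1 / (2 * b)) (k j : ℕ) :
    v (k + j) ≤ j * G * b ^ j + (1 / (2 * b)) ^ j *
      Real.exp (Real.log (2 * b ^ 2) / l * ∑ i ∈ Finset.range j, s (k + i)) * v k := by
  have hb0 : 0 < b := by linarith
  have hlog : 0 ≤ Real.log (2 * b ^ 2) := Real.log_nonneg (by nlinarith)
  have hw : ∀ i, β i ≤ 1 / (2 * b) * Real.exp (Real.log (2 * b ^ 2) / l * s i) := by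
    intro i
    rcases le_or_gt (s i) l with h | h
    · refine (hβs i h).trans (le_mul_of_one_le_right (by positivity) (Real.one_le_exp ?_))
      exact mul_nonneg (by positivity) (hs i)
    · refine (hβ i).trans ?_
      have h1 : 2 * b ^ 2 ≤ Real.exp (Real.log (2 * b ^ 2) / l * s i) := by
        rw [← Real.log_le_iff_le_exp (by positivity), div_mul_eq_mul_div, le_div_iff₀ hl]
        gcongr
      calc b = 1 / (2 * b) * (2 * b ^ 2) := by field_simp
        _ ≤ _ := by gcongr
  induction j with
  | zero => simp
  | succ j ih =>
    set A := (1 / (2 * b)) ^ j *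
      Real.exp (Real.log (2 * b ^ 2) / l * ∑ i ∈ Finset.range j, s (k + i)) with hA
    have hA0 : 0 ≤ A := by positivity
    have hAs : (1 / (2 * b)) ^ (j + 1) *
        Real.exp (Real.log (2 * b ^ 2) / l * ∑ i ∈ Finset.range (j + 1), s (k + i))
        = (1 / (2 * b) * Real.exp (Real.log (2 * b ^ 2) / l * s (k + j))) * A := by
      rw [Finset.sum_range_succ, mul_add, Real.exp_add, hA]; ring
    rw [hAs]
    have hpow : 1 ≤ b ^ (j + 1) := one_le_pow₀ hb.le
    have hvk := hv k
    calc v (k + (j + 1)) ≤ G + β (k + j) * v (k + j) := hrec (k + j)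
      _ ≤ G + β (k + j) * (j * G * b ^ j + A * v k) := by
        gcongr
        exact hβ0 _
      _ = G + β (k + j) * (j * G * b ^ j) + β (k + j) * (A * v k) := by ring
      _ ≤ G * b ^ (j + 1) + b * (j * G * b ^ j)
          + (1 / (2 * b) * Real.exp (Real.log (2 * b ^ 2) / l * s (k + j))) * (A * v k) := by
        gcongr
        · exact le_mul_of_one_le_right hG hpow
        · exact hβ _
        · exact hw _
      _ = _ := by push_cast; ring

/-- A sequence tending to infinity cannot satisfy `v (k + m) ≤ C + v k / 2` eventually. -/
lemma not_tendsto_atTop_of_le_add_half {v : ℕ → ℝ} {C : ℝ} {m : ℕ} (hm : 0 < m)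
    (h : ∀ᶠ k in atTop, v (k + m) ≤ C + 1 / 2 * v k) : ¬ Tendsto v atTop atTop := by
  intro hv
  obtain ⟨K, hK⟩ := eventually_atTop.mp h
  have hbd : ∀ j : ℕ, v (K + j * m) ≤ max (v K) (2 * C) := by
    intro j
    induction j with
    | zero => simp
    | succ j ih =>
      have h1 := hK (K + j * m) (by omega)
      rw [show K + (j + 1) * m = K + j * m + m by ring]
      linarith [le_max_right (v K) (2 * C)]
  have hsub : Tendsto (fun j : ℕ => K + j * m) atTop atTop :=
    tendsto_atTop_mono (fun j => (Nat.le_mul_of_pos_right j hm).trans (Nat.le_add_left _ K))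
      tendsto_id
  obtain ⟨j, hj⟩ := ((hv.comp hsub).eventually_gt_atTop (max (v K) (2 * C))).exists
  exact absurd (hbd j) (not_le.mpr hj)

/-- Curvature condition and Lipschitz continuity bound the step size from below. -/
lemma curvature_step_bound {H : Type*} [NormedAddCommGroup H] [InnerProductSpace ℝ H]
    {g g' d : H} {a σ : ℝ} (hLip : ‖g' - g‖ ≤ 2 * (a * ‖d‖)) (hW : σ * ⟪g, d⟫ ≤ ⟪g', d⟫) :
    (1 - σ) * -⟪g, d⟫ ≤ 2 * a * ‖d‖ ^ 2 := by
  have h1 := real_inner_le_norm (g' - g) d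
  rw [inner_sub_left] at h1
  have h2 := mul_le_mul_of_nonneg_right hLip (norm_nonneg d)
  nlinarith

/-- If β n ≥ 0, the sufficient descent condition holds, (x n) is bounded, and
Property (⋆) holds, then liminf ‖x n − T (x n)‖ = 0. -/
theorem stmt_13 {H : Type*} [NormedAddCommGroup H] [InnerProductSpace ℝ H] [CompleteSpace H]
    (T : H → H) (hT : ∀ x y : H, ‖T x - T y‖ ≤ ‖x - y‖) (hFix : ∃ p : H, T p = p)
    (δ σ : ℝ) (hδ : δ ∈ Set.Ioo (0:ℝ) 1) (hσ : σ ∈ Set.Ioo (0:ℝ) 1) (hδσ : δ ≤ σ)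
    (x d : ℕ → H) (α : ℕ → ℝ) (β : ℕ → ℝ) (hα : ∀ n, α n ∈ Set.Ioc (0:ℝ) 1)
    (hx : ∀ n, x (n+1) = x n + α n • d n)
    (hA : ∀ n, ‖x (n+1) - T (x (n+1))‖ ^ 2 - ‖x n - T (x n)‖ ^ 2
      ≤ δ * α n * ⟪x n - T (x n), d n⟫)
    (hW : ∀ n, σ * ⟪x n - T (x n), d n⟫ ≤ ⟪x (n+1) - T (x (n+1)), d n⟫)
    (hd0 : d 0 = -(x 0 - T (x 0)))
    (hd : ∀ n, d (n+1) = -(x (n+1) - T (x (n+1))) + β n • d n)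
    (hβpos : ∀ n, 0 ≤ β n)
    (c : ℝ) (hc : 0 < c)
    (hdesc : ∀ n, ⟪x n - T (x n), d n⟫ ≤ -c * ‖x n - T (x n)‖ ^ 2)
    (hbdd : Bornology.IsBounded (Set.range x))
    (hstar : (∃ γ > (0:ℝ), ∃ γbar > (0:ℝ),
        ∀ n, γ ≤ ‖x n - T (x n)‖ ∧ ‖x n - T (x n)‖ ≤ γbar) →
      ∃ b > (1:ℝ), ∃ lam > (0:ℝ), (∀ n, |β n| ≤ b) ∧
        ∀ n, ‖x (n+1) - x n‖ ≤ lam → |β n| ≤ 1 / (2 * b)) :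
    liminf (fun n => ‖x n - T (x n)‖) atTop = 0 := by
  set g : ℕ → H := fun n => x n - T (x n) with hg
  change ∀ n, ‖g (n+1)‖ ^ 2 - ‖g n‖ ^ 2 ≤ δ * α n * ⟪g n, d n⟫ at hA
  change ∀ n, σ * ⟪g n, d n⟫ ≤ ⟪g (n+1), d n⟫ at hW
  change ∀ n, d (n+1) = -g (n+1) + β n • d n at hd
  change ∀ n, ⟪g n, d n⟫ ≤ -c * ‖g n‖ ^ 2 at hdesc
  change liminf (fun n => ‖g n‖) atTop = 0
  have hanti : Antitone (fun n => ‖g n‖) := by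
    refine antitone_nat_of_succ_le fun n => ?_
    have h1 : ⟪g n, d n⟫ ≤ 0 := (hdesc n).trans (by nlinarith [sq_nonneg ‖g n‖])
    have h2 : δ * α n * ⟪g n, d n⟫ ≤ 0 :=
      mul_nonpos_of_nonneg_of_nonpos (mul_nonneg hδ.1.le (hα n).1.le) h1
    exact le_of_sq_le_sq (by linarith [hA n]) (norm_nonneg _)
  have hbelow : BddBelow (Set.range fun n => ‖g n‖) := ⟨0, by rintro _ ⟨n, rfl⟩; exact norm_nonneg _⟩
  have hlim := tendsto_atTop_ciInf hanti hbelow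
  rw [hlim.liminf_eq]
  have hL0 : 0 ≤ ⨅ n, ‖g n‖ := Real.iInf_nonneg fun n => norm_nonneg _
  by_contra hne
  obtain ⟨γ, hγdef⟩ : ∃ γ, γ = ⨅ n, ‖g n‖ := ⟨_, rfl⟩
  rw [← hγdef] at hlim hL0 hne
  have hγ : 0 < γ := lt_of_le_of_ne hL0 (Ne.symm hne)
  have hγle : ∀ n, γ ≤ ‖g n‖ := fun n => hγdef ▸ ciInf_le hbelow n
  obtain ⟨G, hGdef⟩ : ∃ G, G = ‖g 0‖ := ⟨_, rfl⟩
  have hgle : ∀ n, ‖g n‖ ≤ G := fun n => hGdef ▸ hanti (Nat.zero_le n)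
  have hG : 0 < G := hγ.trans_le ((hγle 0).trans (hgle 0))
  obtain ⟨b, hb, l, hl, hβb, hβl⟩ := hstar ⟨γ, hγ, G, hG, fun n => ⟨hγle n, hgle n⟩⟩
  have hgd : ∀ n, c * γ ^ 2 ≤ -⟪g n, d n⟫ := by
    intro n
    have : c * γ ^ 2 ≤ c * ‖g n‖ ^ 2 := by gcongr; exact hγle n
    linarith [hdesc n]
  have hcγ : 0 < c * γ ^ 2 := by positivity
  have hd0' : ∀ n, d n ≠ 0 := by
    intro n h
    have := hgd n
    rw [h, inner_zero_right] at this
    linarith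
  have hdpos : ∀ n, 0 < ‖d n‖ := fun n => norm_pos_iff.mpr (hd0' n)
  have hstep : ∀ n, x (n+1) - x n = α n • d n := fun n => by rw [hx, add_sub_cancel_left]
  have hstepn : ∀ n, ‖x (n+1) - x n‖ = α n * ‖d n‖ := fun n => by
    rw [hstep, norm_smul, Real.norm_of_nonneg (hα n).1.le]
  have hdtop : Tendsto (fun n => ‖d n‖) atTop atTop := by
    have hlow : ∀ n, δ * ((1 - σ) * (c * γ ^ 2) ^ 2)
        ≤ 2 * (‖g n‖ ^ 2 - ‖g (n+1)‖ ^ 2) * ‖d n‖ ^ 2 := by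
      intro n
      have hLip : ‖g (n+1) - g n‖ ≤ 2 * (α n * ‖d n‖) := by
        have h1 : g (n+1) - g n = (x (n+1) - x n) - (T (x (n+1)) - T (x n)) := by
          simp only [hg]; abel
        have h2 := norm_sub_le (x (n+1) - x n) (T (x (n+1)) - T (x n))
        rw [h1, ← hstepn]
        linarith [hT (x (n+1)) (x n)]
      have hc1 := curvature_step_bound hLip (hW n)
      have hq := hgd n
      have hA' := hA n
      set q := -⟪g n, d n⟫ with hqdef
      have hq0 : 0 ≤ q := hcγ.le.trans hq
      have hσ1 : 0 ≤ 1 - σ := by linarith [hσ.2]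
      have hA2 : δ * α n * q ≤ ‖g n‖ ^ 2 - ‖g (n+1)‖ ^ 2 := by
        rw [hqdef]; linarith
      calc δ * ((1 - σ) * (c * γ ^ 2) ^ 2) ≤ δ * ((1 - σ) * q ^ 2) := by
            have := hδ.1.le
            gcongr
        _ = δ * q * ((1 - σ) * q) := by ring
        _ ≤ δ * q * (2 * α n * ‖d n‖ ^ 2) := by
            have := hδ.1.le
            gcongr
        _ = 2 * (δ * α n * q) * ‖d n‖ ^ 2 := by ring
        _ ≤ _ := by gcongr
    have hdiff : Tendsto (fun n => 2 * (‖g n‖ ^ 2 - ‖g (n+1)‖ ^ 2)) atTop (nhds 0) := by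
      have h1 := (hlim.pow 2).sub (((tendsto_add_atTop_iff_nat 1).mpr hlim).pow 2)
      simpa using h1.const_mul 2
    have hE : 0 < δ * ((1 - σ) * (c * γ ^ 2) ^ 2) := by
      have := hδ.1
      have : 0 < 1 - σ := by linarith [hσ.2]
      positivity
    set E := δ * ((1 - σ) * (c * γ ^ 2) ^ 2) with hEdef
    refine tendsto_atTop.mpr fun r => ?_
    filter_upwards [hdiff.eventually_lt_const (show 0 < E / (r ^ 2 + 1) by positivity)] with n hn
    by_contra! hr
    have h1 : ‖d n‖ ^ 2 < r ^ 2 + 1 := by nlinarith [norm_nonneg (d n)]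
    have h2 := hlow n
    rw [lt_div_iff₀ (by positivity)] at hn
    have hd2 : 0 < ‖d n‖ ^ 2 := pow_pos (hdpos n) 2
    have hpos : 0 < 2 * (‖g n‖ ^ 2 - ‖g (n+1)‖ ^ 2) := by
      by_contra! hneg
      nlinarith
    nlinarith
  set u : ℕ → H := fun n => ‖d n‖⁻¹ • d n with hu
  have hunorm : ∀ n, ‖u n‖ = 1 := fun n => by
    rw [hu]; simp only
    rw [norm_smul, norm_inv, norm_norm, inv_mul_cancel₀ (hdpos n).ne']
  have hudiff : Tendsto (fun n => ‖u (n+1) - u n‖) atTop (nhds 0) := by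
    have h1 : Tendsto (fun n => 2 * G / ‖d (n+1)‖) atTop (nhds 0) :=
      Tendsto.const_div_atTop ((tendsto_add_atTop_iff_nat 1).mpr hdtop) _
    refine squeeze_zero (fun n => norm_nonneg _) (fun n => ?_) h1
    refine (norm_normalize_sub_normalize_le_s13 (hβpos n) (hd n) (hd0' _) (hd0' n)).trans ?_
    gcongr
    exact hgle _
  obtain ⟨R, hR⟩ := Metric.isBounded_range_iff.mp hbdd
  have hb0 : 0 < b := by linarith
  obtain ⟨m, hm⟩ : ∃ m : ℕ, (1 / (2 * b)) ^ m *
      Real.exp (Real.log (2 * b ^ 2) / l * (2 * R)) < 1 / 2 := by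
    have h1 : Tendsto (fun m : ℕ => (1 / (2 * b)) ^ m) atTop (nhds 0) :=
      tendsto_pow_atTop_nhds_zero_of_lt_one (by positivity)
        (by rw [div_lt_one (by positivity)]; linarith)
    have h2 := h1.mul_const (Real.exp (Real.log (2 * b ^ 2) / l * (2 * R)))
    rw [zero_mul] at h2
    exact (h2.eventually_lt_const (by norm_num)).exists
  have hlog : 0 ≤ Real.log (2 * b ^ 2) := Real.log_nonneg (by nlinarith)
  have hR0 : 0 ≤ R := dist_nonneg.trans (hR 0 0)
  have hm0 : 0 < m := by
    rcases Nat.eq_zero_or_pos m with h | h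
    · subst h
      have : 1 ≤ Real.exp (Real.log (2 * b ^ 2) / l * (2 * R)) := Real.one_le_exp (by positivity)
      rw [pow_zero, one_mul] at hm
      linarith
    · exact h
  refine not_tendsto_atTop_of_le_add_half (C := m * G * b ^ m) hm0 ?_ hdtop
  have hmR : (0 : ℝ) < m := by exact_mod_cast hm0
  obtain ⟨K, hK⟩ := eventually_atTop.mp
    (hudiff.eventually_lt_const (show 0 < 1 / (2 * (m : ℝ)) by positivity))
  filter_upwards [eventually_ge_atTop K] with k hk
  have hnear : ∀ i, ‖u (k + i) - u k‖ ≤ i * (1 / (2 * (m : ℝ))) := by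
    intro i
    induction i with
    | zero => simp
    | succ i ih =>
      have h1 := hK (k + i) (by omega)
      have h2 := norm_add_le (u (k + i + 1) - u (k + i)) (u (k + i) - u k)
      rw [sub_add_sub_cancel] at h2
      rw [← add_assoc]
      push_cast
      linarith
  have hsum : ∑ i ∈ Finset.range m, ‖x (k + i + 1) - x (k + i)‖ ≤ 2 * R := by
    have h1 := sum_norm_le_two_mul_norm_sum (Finset.range m)
      (fun i => x (k + i + 1) - x (k + i)) (fun i => u (k + i)) (u k) (hunorm k)
      (fun i _ => by
        rw [hstepn, hstep, hu, smul_smul, mul_assoc, mul_inv_cancel₀ (hdpos _).ne', mul_one])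
      (fun i hi => by
        refine (hnear i).trans ?_
        have h3 : (i : ℝ) ≤ m := by exact_mod_cast (Finset.mem_range.mp hi).le
        rw [mul_one_div, div_le_div_iff₀ (by positivity) (by norm_num)]
        linarith)
    have h2 : ∑ i ∈ Finset.range m, (x (k + i + 1) - x (k + i)) = x (k + m) - x k := by
      simpa [add_assoc] using Finset.sum_range_sub (fun i => x (k + i)) m
    rw [h2, ← dist_eq_norm] at h1
    linarith [hR (k + m) k]
  have hrec : ∀ i, ‖d (i + 1)‖ ≤ G + β i * ‖d i‖ := by
    intro i
    rw [hd i]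
    refine (norm_add_le _ _).trans ?_
    rw [norm_neg, norm_smul, Real.norm_of_nonneg (hβpos i)]
    linarith [hgle (i + 1)]
  refine (le_add_mul_exp_sum_of_damped (v := fun n => ‖d n‖) (s := fun n => ‖x (n + 1) - x n‖)
    hG.le hb hl (fun n => norm_nonneg _) (fun n => norm_nonneg _) hrec hβpos
    (fun i => (le_abs_self _).trans (hβb i))
    (fun i hi => (le_abs_self _).trans (hβl i hi)) k m).trans ?_
  gcongr
  refine le_trans ?_ hm.le
  gcongr
end

section
/- Suppose that the PRP+ formula β_n = β_n^{PRP+} := max{ ⟨x_{n+1} − T(x_{n+1}), y_n⟩ / ‖x_n − T(x_n)‖², 0 } is used, that ‖x_n − T(x_n)‖ ≠ 0 for all n ∈ ℕ, that there exists c > 0 such that ⟨x_n − T(x_n), d_n⟩ ≤ −c ‖x_n − T(x_n)‖² for all n ∈ ℕ, and that (x_n)_{n∈ℕ} is bounded. Then lim_{n→∞} ‖x_n − T(x_n)‖ = 0. -/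
open RealInnerProductSpace Filter

/-- The displacement `id - T` of a nonexpansive map is `1/2`-cocoercive. -/
theorem norm_sq_displacement_sub_le {H : Type*} [NormedAddCommGroup H] [InnerProductSpace ℝ H]
    {T : H → H} (hT : ∀ x y : H, ‖T x - T y‖ ≤ ‖x - y‖) (u v : H) :
    ‖(u - T u) - (v - T v)‖ ^ 2 ≤ 2 * ⟪(u - T u) - (v - T v), u - v⟫ := by
  have h : T u - T v = (u - v) - ((u - T u) - (v - T v)) := by abel
  have h1 := pow_le_pow_left₀ (norm_nonneg _) (hT u v) 2
  rw [h, norm_sub_sq_real, real_inner_comm] at h1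
  linarith

/-- The displacement `id - T` of a nonexpansive map is `2`-Lipschitz. -/
theorem norm_displacement_sub_le {H : Type*} [SeminormedAddCommGroup H]
    {T : H → H} (hT : ∀ x y : H, ‖T x - T y‖ ≤ ‖x - y‖) (u v : H) :
    ‖(u - T u) - (v - T v)‖ ≤ 2 * ‖u - v‖ := by
  have h : (u - T u) - (v - T v) = (u - v) - (T u - T v) := by abel
  rw [h]
  linarith [norm_sub_le (u - v) (T u - T v), hT u v]

/-- A real sequence with `u (n + 1) ≤ C + u n / 2` from `N` on is bounded from `N` on. -/
theorem exists_bound_of_le_add_half {u : ℕ → ℝ} {C : ℝ} {N : ℕ}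
    (h : ∀ n ≥ N, u (n + 1) ≤ C + u n / 2) : ∃ M, ∀ n ≥ N, u n ≤ M := by
  refine ⟨max (u N) (2 * C), fun n hn => ?_⟩
  induction n, hn using Nat.le_induction with
  | base => exact le_max_left _ _
  | succ n hn ih => linarith [h n hn, le_max_right (u N) (2 * C)]

section PRPPlus

variable {H : Type*} [NormedAddCommGroup H] [InnerProductSpace ℝ H]

/-- If `g` does not increase in norm, the PRP+ parameter is controlled by the increment of `g`. -/
theorem two_mul_norm_sq_mul_prp_le {g g' : H} (hg : ‖g‖ ≠ 0) (h : ‖g'‖ ≤ ‖g‖) :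
    2 * ‖g‖ ^ 2 * max (⟪g', g' - g⟫ / ‖g‖ ^ 2) 0 ≤ ‖g' - g‖ ^ 2 := by
  have hpos : 0 < ‖g‖ ^ 2 := by positivity
  rcases max_cases (⟪g', g' - g⟫ / ‖g‖ ^ 2) 0 with ⟨hm, -⟩ | ⟨hm, -⟩
  · rw [hm, mul_assoc, mul_div_cancel₀ _ hpos.ne', inner_sub_right, norm_sub_sq_real,
      real_inner_self_eq_norm_sq]
    nlinarith [norm_nonneg g', norm_nonneg g]
  · rw [hm, mul_zero]
    positivity

/-- Conjugate-gradient type iterations with PRP+ directions, Armijo decrease and the curvature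
condition cannot keep the residuals `g n` bounded away from zero. -/
theorem not_residual_bounded_below {g d : ℕ → H} {α β : ℕ → ℝ} {δ σ c ε : ℝ}
    (hδ : 0 < δ) (hσ : σ < 1) (hc : 0 < c) (hε : 0 < ε)
    (hα : ∀ n, 0 < α n)
    (hA : ∀ n, ‖g (n + 1)‖ ^ 2 - ‖g n‖ ^ 2 ≤ δ * α n * ⟪g n, d n⟫)
    (hW : ∀ n, σ * ⟪g n, d n⟫ ≤ ⟪g (n + 1), d n⟫)
    (hd : ∀ n, d (n + 1) = -g (n + 1) + β n • d n)
    (hβ0 : ∀ n, 0 ≤ β n)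
    (hβ : ∀ n, 2 * ‖g n‖ ^ 2 * β n ≤ ‖g (n + 1) - g n‖ ^ 2)
    (hdesc : ∀ n, ⟪g n, d n⟫ ≤ -c * ‖g n‖ ^ 2)
    (hanti : Antitone fun n => ‖g n‖)
    (hcoc : ∀ n, ‖g (n + 1) - g n‖ ^ 2 ≤ 2 * (α n * ⟪g (n + 1) - g n, d n⟫))
    (hlip : ∀ n, ‖g (n + 1) - g n‖ ≤ 2 * (α n * ‖d n‖)) :
    ¬ ∀ n, ε ≤ ‖g n‖ := by
  intro hlow
  set E := ε ^ 2 with hE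
  have hEpos : 0 < E := by positivity
  have hlow2 : ∀ n, E ≤ ‖g n‖ ^ 2 := fun n => pow_le_pow_left₀ hε.le (hlow n) 2
  have he : ∀ n, c * E ≤ -⟪g n, d n⟫ := fun n => by
    linarith [hdesc n, mul_le_mul_of_nonneg_left (hlow2 n) hc.le]
  have hlim : Tendsto (fun n => ‖g n‖) atTop (nhds (⨅ n, ‖g n‖)) :=
    tendsto_atTop_ciInf hanti ⟨0, by rintro _ ⟨n, rfl⟩; exact norm_nonneg _⟩
  have hdiff : Tendsto (fun n => (‖g n‖ ^ 2 - ‖g (n + 1)‖ ^ 2) / δ) atTop (nhds 0) := by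
    simpa using ((hlim.pow 2).sub (((tendsto_add_atTop_iff_nat 1).2 hlim).pow 2)).div_const δ
  have hw : Tendsto (fun n => α n * -⟪g n, d n⟫) atTop (nhds 0) := by
    refine squeeze_zero (fun n => mul_nonneg (hα n).le ((by positivity : 0 ≤ c * E).trans (he n)))
      (fun n => ?_) hdiff
    rw [le_div_iff₀ hδ]
    linarith [hA n]
  have hα0 : Tendsto α atTop (nhds 0) := by
    refine squeeze_zero (fun n => (hα n).le) (fun n => ?_)
      (by simpa using hw.div_const (c * E) :
        Tendsto (fun n => α n * -⟪g n, d n⟫ / (c * E)) atTop (nhds 0))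
    rw [le_div_iff₀ (by positivity)]
    exact mul_le_mul_of_nonneg_left (he n) (hα n).le
  have hβhalf : ∀ᶠ n in atTop, β n ≤ 1 / 2 := by
    have h1 : ∀ᶠ n in atTop, α n * ‖g 0‖ ^ 2 < E / 8 :=
      (by simpa using hα0.mul_const (‖g 0‖ ^ 2) :
        Tendsto (fun n => α n * ‖g 0‖ ^ 2) atTop (nhds 0)).eventually_lt_const (by positivity)
    have h2 : ∀ᶠ n in atTop, α n * -⟪g n, d n⟫ < E / 4 :=
      hw.eventually_lt_const (by positivity)
    filter_upwards [h1, h2] with n h1 h2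
    by_contra! hn
    have hinner : β n * ⟪g (n + 1), d n⟫ ≤ ‖g 0‖ ^ 2 := by
      have h := hdesc (n + 1)
      rw [hd, inner_add_right, inner_neg_right, real_inner_self_eq_norm_sq,
        real_inner_smul_right] at h
      have h0 := pow_le_pow_left₀ (norm_nonneg _) (hanti (Nat.zero_le (n + 1))) 2
      have : 0 ≤ c * ‖g (n + 1)‖ ^ 2 := by positivity
      simp only at h0
      linarith
    have hsq : E * β n ^ 2 ≤ α n * (β n * ⟪g (n + 1), d n⟫) + β n * (α n * -⟪g n, d n⟫) := by
      have h3 := mul_le_mul_of_nonneg_left ((hβ n).trans (hcoc n)) (hβ0 n)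
      have h4 := mul_le_mul_of_nonneg_right (hlow2 n) (sq_nonneg (β n))
      rw [inner_sub_left] at h3
      linarith
    have h5 := mul_le_mul_of_nonneg_left hinner (hα n).le
    have h6 := mul_le_mul_of_nonneg_left h2.le (hβ0 n)
    have h7 : 0 < E * ((β n - 1 / 2) * (β n + 1 / 4)) := by
      have : 0 < β n - 1 / 2 := by linarith
      have : 0 < β n + 1 / 4 := by linarith
      positivity
    linarith
  obtain ⟨N, hN⟩ := eventually_atTop.1 hβhalf
  obtain ⟨M, hM⟩ := exists_bound_of_le_add_half (u := fun n => ‖d n‖) (C := ‖g 0‖) (N := N)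
    fun n hn => by
      have h1 : ‖d (n + 1)‖ ≤ ‖g (n + 1)‖ + β n * ‖d n‖ := by
        rw [hd]
        refine (norm_add_le _ _).trans_eq ?_
        rw [norm_neg, norm_smul, Real.norm_of_nonneg (hβ0 n)]
      have h2 := mul_le_mul_of_nonneg_right (hN n hn) (norm_nonneg (d n))
      have h3 : ‖g (n + 1)‖ ≤ ‖g 0‖ := hanti (Nat.zero_le (n + 1))
      linarith
  have hsmall : ∀ᶠ n in atTop, α n * (2 * M ^ 2) < (1 - σ) * (c * E) :=
    (by simpa using hα0.mul_const (2 * M ^ 2) :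
      Tendsto (fun n => α n * (2 * M ^ 2)) atTop (nhds 0)).eventually_lt_const
        (mul_pos (by linarith) (by positivity))
  obtain ⟨n, hn, hnN⟩ := (hsmall.and (eventually_ge_atTop N)).exists
  have h1 : ⟪g (n + 1) - g n, d n⟫ ≤ 2 * (α n * ‖d n‖) * ‖d n‖ :=
    (real_inner_le_norm _ _).trans (mul_le_mul_of_nonneg_right (hlip n) (norm_nonneg _))
  rw [inner_sub_left] at h1
  have h2 := mul_le_mul_of_nonneg_left (pow_le_pow_left₀ (norm_nonneg _) (hM n hnN) 2) (hα n).le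
  have h3 := mul_le_mul_of_nonneg_left (he n) (by linarith : 0 ≤ 1 - σ)
  linarith [hW n]

end PRPPlus

/-- PRP+ direction: if the sufficient descent condition holds and (x n) is bounded,
then lim ‖x n − T (x n)‖ = 0. -/
theorem stmt_14 {H : Type*} [NormedAddCommGroup H] [InnerProductSpace ℝ H] [CompleteSpace H]
    (T : H → H) (hT : ∀ x y : H, ‖T x - T y‖ ≤ ‖x - y‖) (hFix : ∃ p : H, T p = p)
    (δ σ : ℝ) (hδ : δ ∈ Set.Ioo (0:ℝ) 1) (hσ : σ ∈ Set.Ioo (0:ℝ) 1) (hδσ : δ ≤ σ)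
    (x d : ℕ → H) (α : ℕ → ℝ) (β : ℕ → ℝ) (hα : ∀ n, α n ∈ Set.Ioc (0:ℝ) 1)
    (hx : ∀ n, x (n+1) = x n + α n • d n)
    (hA : ∀ n, ‖x (n+1) - T (x (n+1))‖ ^ 2 - ‖x n - T (x n)‖ ^ 2
      ≤ δ * α n * ⟪x n - T (x n), d n⟫)
    (hW : ∀ n, σ * ⟪x n - T (x n), d n⟫ ≤ ⟪x (n+1) - T (x (n+1)), d n⟫)
    (hd0 : d 0 = -(x 0 - T (x 0)))
    (hd : ∀ n, d (n+1) = -(x (n+1) - T (x (n+1))) + β n • d n)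
    (hβ : ∀ n, β n = max
      (⟪x (n+1) - T (x (n+1)), (x (n+1) - T (x (n+1))) - (x n - T (x n))⟫
        / ‖x n - T (x n)‖ ^ 2) 0)
    (hnz : ∀ n, ‖x n - T (x n)‖ ≠ 0)
    (c : ℝ) (hc : 0 < c)
    (hdesc : ∀ n, ⟪x n - T (x n), d n⟫ ≤ -c * ‖x n - T (x n)‖ ^ 2)
    (hbdd : Bornology.IsBounded (Set.range x)) :
    Tendsto (fun n => ‖x n - T (x n)‖) atTop (nhds 0) := by
  have hstep : ∀ n, x (n + 1) - x n = α n • d n := fun n => by rw [hx, add_sub_cancel_left]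
  have hanti : Antitone fun n => ‖x n - T (x n)‖ := by
    refine antitone_nat_of_succ_le fun n => ?_
    refine (sq_le_sq₀ (norm_nonneg _) (norm_nonneg _)).1 ?_
    have h1 : ⟪x n - T (x n), d n⟫ ≤ 0 :=
      (hdesc n).trans (by nlinarith [sq_nonneg ‖x n - T (x n)‖])
    linarith [hA n, mul_nonpos_of_nonneg_of_nonpos (mul_pos hδ.1 (hα n).1).le h1]
  have hbelow : BddBelow (Set.range fun n => ‖x n - T (x n)‖) :=
    ⟨0, by rintro _ ⟨n, rfl⟩; exact norm_nonneg _⟩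
  have hlim := tendsto_atTop_ciInf hanti hbelow
  rcases (Real.iInf_nonneg fun n => norm_nonneg (x n - T (x n))).eq_or_lt with h0 | hpos
  · rwa [← h0] at hlim
  · refine absurd (fun n => ciInf_le hbelow n) (not_residual_bounded_below
      (g := fun n => x n - T (x n)) hδ.1 hσ.2 hc hpos (fun n => (hα n).1) hA hW hd ?_ ?_ hdesc
      hanti ?_ ?_)
    · intro n
      rw [hβ]
      exact le_max_right _ _
    · intro n
      rw [hβ]
      exact two_mul_norm_sq_mul_prp_le (hnz n) (hanti n.le_succ)
    · intro n
      have h := norm_sq_displacement_sub_le hT (x (n + 1)) (x n)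
      rwa [hstep, real_inner_smul_right] at h
    · intro n
      have h := norm_displacement_sub_le hT (x (n + 1)) (x n)
      rwa [hstep, norm_smul, Real.norm_of_nonneg (hα n).1.le] at h
end

section
/- Suppose that the HS+ formula β_n = β_n^{HS+} := max{ ⟨x_{n+1} − T(x_{n+1}), y_n⟩ / ⟨d_n, y_n⟩, 0 } is used, that ‖x_n − T(x_n)‖ ≠ 0 for all n ∈ ℕ, that there exists c > 0 such that ⟨x_n − T(x_n), d_n⟩ ≤ −c ‖x_n − T(x_n)‖² for all n ∈ ℕ, and that (x_n)_{n∈ℕ} is bounded. Then lim_{n→∞} ‖x_n − T(x_n)‖ = 0. -/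
open RealInnerProductSpace Filter

/-- If `T` is nonexpansive then `id - T` is `1/2`-cocoercive. -/
theorem norm_sq_residual_sub_le_two_mul_inner {H : Type*} [NormedAddCommGroup H]
    [InnerProductSpace ℝ H] {T : H → H} (hT : ∀ x y : H, ‖T x - T y‖ ≤ ‖x - y‖) (x y : H) :
    ‖(x - T x) - (y - T y)‖ ^ 2 ≤ 2 * ⟪x - y, (x - T x) - (y - T y)⟫ := by
  have hsq : ‖T x - T y‖ ^ 2 ≤ ‖x - y‖ ^ 2 := by gcongr; exact hT x y
  have hexp := norm_sub_sq_real (x - y) ((x - T x) - (y - T y))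
  rw [show (x - y) - ((x - T x) - (y - T y)) = T x - T y by abel] at hexp
  linarith

/-- A real sequence with `u (n + 1) ≤ G + u n / 2` eventually is bounded above eventually. -/
theorem exists_eventually_le_of_eventually_le_add_half {u : ℕ → ℝ} {G : ℝ}
    (h : ∀ᶠ n in atTop, u (n + 1) ≤ G + u n / 2) : ∃ D, ∀ᶠ n in atTop, u n ≤ D := by
  obtain ⟨N, hN⟩ := eventually_atTop.1 h
  refine ⟨max (2 * G) (u N), eventually_atTop.2 ⟨N, fun n hn => ?_⟩⟩
  induction n, hn using Nat.le_induction with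
  | base => exact le_max_right _ _
  | succ n hn ih =>
    have h1 := hN n hn
    have h2 := le_max_left (2 * G) (u N)
    linarith

/-- The Hestenes–Stiefel quotient is controlled by the step size for a cocoercive residual. -/
theorem max_inner_div_inner_sq_le {H : Type*} [NormedAddCommGroup H] [InnerProductSpace ℝ H]
    {g y d : H} {a G K : ℝ} (ha : 0 ≤ a) (hg : ‖g‖ ≤ G) (hK : 0 < K) (hKd : K ≤ ⟪d, y⟫)
    (hy : ‖y‖ ^ 2 ≤ 2 * a * ⟪d, y⟫) :
    (max (⟪g, y⟫ / ⟪d, y⟫) 0) ^ 2 ≤ 2 * G ^ 2 / K * a := by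
  have hp : 0 < ⟪d, y⟫ := hK.trans_le hKd
  have hnum : ⟪g, y⟫ ^ 2 ≤ G ^ 2 * (2 * a * ⟪d, y⟫) := by
    calc ⟪g, y⟫ ^ 2 ≤ (‖g‖ * ‖y‖) ^ 2 := by
          rw [← sq_abs]; gcongr; exact abs_real_inner_le_norm g y
      _ = ‖g‖ ^ 2 * ‖y‖ ^ 2 := by ring
      _ ≤ G ^ 2 * (2 * a * ⟪d, y⟫) := by gcongr
  have hquot : (⟪g, y⟫ / ⟪d, y⟫) ^ 2 ≤ 2 * G ^ 2 / K * a := by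
    calc (⟪g, y⟫ / ⟪d, y⟫) ^ 2 ≤ G ^ 2 * (2 * a * ⟪d, y⟫) / ⟪d, y⟫ ^ 2 := by
          rw [div_pow]; gcongr
      _ = 2 * G ^ 2 * a / ⟪d, y⟫ := by field_simp
      _ ≤ 2 * G ^ 2 * a / K := by gcongr
      _ = 2 * G ^ 2 / K * a := by ring
  rcases le_total (⟪g, y⟫ / ⟪d, y⟫) 0 with h | h
  · rw [max_eq_right h, zero_pow two_ne_zero]
    positivity
  · rwa [max_eq_left h]

/-- A step along `d` with cocoercive residual increment `y` cannot be short unless `d` is long. -/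
theorem inner_le_two_mul_norm_sq {H : Type*} [NormedAddCommGroup H] [InnerProductSpace ℝ H]
    {y d : H} {a : ℝ} (hp : 0 < ⟪d, y⟫) (hy : ‖y‖ ^ 2 ≤ 2 * a * ⟪d, y⟫) :
    ⟪d, y⟫ ≤ 2 * a * ‖d‖ ^ 2 := by
  refine le_of_mul_le_mul_right ?_ hp
  calc ⟪d, y⟫ * ⟪d, y⟫ ≤ (‖d‖ * ‖y‖) * (‖d‖ * ‖y‖) := by
        gcongr <;> exact real_inner_le_norm d y
    _ = ‖d‖ ^ 2 * ‖y‖ ^ 2 := by ring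
    _ ≤ ‖d‖ ^ 2 * (2 * a * ⟪d, y⟫) := by gcongr
    _ = 2 * a * ‖d‖ ^ 2 * ⟪d, y⟫ := by ring

/-- HS+ direction: if the sufficient descent condition holds and (x n) is bounded,
then lim ‖x n − T (x n)‖ = 0. -/
theorem stmt_15 {H : Type*} [NormedAddCommGroup H] [InnerProductSpace ℝ H] [CompleteSpace H]
    (T : H → H) (hT : ∀ x y : H, ‖T x - T y‖ ≤ ‖x - y‖) (hFix : ∃ p : H, T p = p)
    (δ σ : ℝ) (hδ : δ ∈ Set.Ioo (0:ℝ) 1) (hσ : σ ∈ Set.Ioo (0:ℝ) 1) (hδσ : δ ≤ σ)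
    (x d : ℕ → H) (α : ℕ → ℝ) (β : ℕ → ℝ) (hα : ∀ n, α n ∈ Set.Ioc (0:ℝ) 1)
    (hx : ∀ n, x (n+1) = x n + α n • d n)
    (hA : ∀ n, ‖x (n+1) - T (x (n+1))‖ ^ 2 - ‖x n - T (x n)‖ ^ 2
      ≤ δ * α n * ⟪x n - T (x n), d n⟫)
    (hW : ∀ n, σ * ⟪x n - T (x n), d n⟫ ≤ ⟪x (n+1) - T (x (n+1)), d n⟫)
    (hd0 : d 0 = -(x 0 - T (x 0)))
    (hd : ∀ n, d (n+1) = -(x (n+1) - T (x (n+1))) + β n • d n)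
    (hβ : ∀ n, β n = max
      (⟪x (n+1) - T (x (n+1)), (x (n+1) - T (x (n+1))) - (x n - T (x n))⟫
        / ⟪d n, (x (n+1) - T (x (n+1))) - (x n - T (x n))⟫) 0)
    (hnz : ∀ n, ‖x n - T (x n)‖ ≠ 0)
    (c : ℝ) (hc : 0 < c)
    (hdesc : ∀ n, ⟪x n - T (x n), d n⟫ ≤ -c * ‖x n - T (x n)‖ ^ 2)
    (hbdd : Bornology.IsBounded (Set.range x)) :
    Tendsto (fun n => ‖x n - T (x n)‖) atTop (nhds 0) := by
  set g : ℕ → H := fun n => x n - T (x n)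
  change ∀ n, ‖g (n + 1)‖ ^ 2 - ‖g n‖ ^ 2 ≤ δ * α n * ⟪g n, d n⟫ at hA
  change ∀ n, σ * ⟪g n, d n⟫ ≤ ⟪g (n + 1), d n⟫ at hW
  change ∀ n, d (n + 1) = -g (n + 1) + β n • d n at hd
  change ∀ n, β n = max (⟪g (n + 1), g (n + 1) - g n⟫ / ⟪d n, g (n + 1) - g n⟫) 0 at hβ
  change ∀ n, ⟪g n, d n⟫ ≤ -c * ‖g n‖ ^ 2 at hdesc
  change Tendsto (fun n => ‖g n‖) atTop (nhds 0)
  have hdecr : ∀ n, δ * c * ‖g n‖ ^ 2 * α n ≤ ‖g n‖ ^ 2 - ‖g (n + 1)‖ ^ 2 := fun n => by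
    have h := mul_le_mul_of_nonneg_left (hdesc n) (mul_pos hδ.1 (hα n).1).le
    linarith [hA n]
  have hanti : Antitone fun n => ‖g n‖ := antitone_nat_of_succ_le fun n => by
    have h : 0 ≤ δ * c * ‖g n‖ ^ 2 * α n := by
      have := hδ.1; have := (hα n).1; positivity
    exact le_of_sq_le_sq (by linarith [hdecr n]) (norm_nonneg _)
  have hbelow : BddBelow (Set.range fun n => ‖g n‖) :=
    ⟨0, by rintro _ ⟨n, rfl⟩; exact norm_nonneg _⟩
  have hlim := tendsto_atTop_ciInf hanti hbelow
  set γ := ⨅ n, ‖g n‖ with hγdef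
  have hγle : ∀ n, γ ≤ ‖g n‖ := fun n => ciInf_le hbelow n
  rcases (le_ciInf fun n => norm_nonneg (g n) : 0 ≤ γ).eq_or_lt with hγ | hγ
  · rwa [hγdef, ← hγ] at hlim
  exfalso
  have hσ' : 0 < 1 - σ := sub_pos.2 hσ.2
  set K := (1 - σ) * (c * γ ^ 2)
  have hK : 0 < K := by positivity
  have hKd : ∀ n, K ≤ ⟪d n, g (n + 1) - g n⟫ := fun n => by
    have h1 : c * γ ^ 2 ≤ -⟪g n, d n⟫ := by
      have : c * γ ^ 2 ≤ c * ‖g n‖ ^ 2 := by gcongr; exact hγle n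
      linarith [hdesc n]
    have h2 := mul_le_mul_of_nonneg_left h1 hσ'.le
    rw [inner_sub_right, real_inner_comm (g (n + 1)), real_inner_comm (g n)]
    linarith [hW n]
  have hy : ∀ n, ‖g (n + 1) - g n‖ ^ 2 ≤ 2 * α n * ⟪d n, g (n + 1) - g n⟫ := fun n => by
    have h := norm_sq_residual_sub_le_two_mul_inner hT (x (n + 1)) (x n)
    rw [show x (n + 1) - x n = α n • d n by rw [hx n]; abel, real_inner_smul_left,
      ← mul_assoc] at h
    exact h
  have hα0 : Tendsto α atTop (nhds 0) := by
    have hδ0 := hδ.1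
    have hdiff : Tendsto (fun n => (‖g n‖ ^ 2 - ‖g (n + 1)‖ ^ 2) / (δ * c * γ ^ 2)) atTop
        (nhds 0) := by
      simpa using ((hlim.pow 2).sub ((hlim.comp (tendsto_add_atTop_nat 1)).pow 2)).div_const
        (δ * c * γ ^ 2)
    refine squeeze_zero (fun n => (hα n).1.le) (fun n => ?_) hdiff
    rw [le_div_iff₀ (by positivity), mul_comm]
    refine le_trans ?_ (hdecr n)
    have := (hα n).1
    gcongr
    exact hγle n
  have hβhalf : ∀ᶠ n in atTop, β n ≤ 1 / 2 := by
    have h := hα0.const_mul (2 * ‖g 0‖ ^ 2 / K)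
    rw [mul_zero] at h
    filter_upwards [h.eventually_le_const (show (0 : ℝ) < (1 / 2) ^ 2 by norm_num)] with n hn
    refine le_of_sq_le_sq (le_trans ?_ hn) (by norm_num)
    rw [hβ n]
    exact max_inner_div_inner_sq_le (hα n).1.le (hanti (Nat.zero_le _)) hK (hKd n) (hy n)
  obtain ⟨D, hD⟩ : ∃ D, ∀ᶠ n in atTop, ‖d n‖ ≤ D := by
    refine exists_eventually_le_of_eventually_le_add_half (G := ‖g 0‖) ?_
    filter_upwards [hβhalf] with n hn
    have hβ0 : 0 ≤ β n := (hβ n).symm ▸ le_max_right _ _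
    calc ‖d (n + 1)‖ ≤ ‖g (n + 1)‖ + β n * ‖d n‖ := by
          rw [hd n]
          refine (norm_add_le _ _).trans_eq ?_
          rw [norm_neg, norm_smul, Real.norm_of_nonneg hβ0]
      _ ≤ ‖g 0‖ + 1 / 2 * ‖d n‖ := by gcongr; exact hanti (Nat.zero_le _)
      _ = ‖g 0‖ + ‖d n‖ / 2 := by ring
  have hKlim : Tendsto (fun n => 2 * α n * D ^ 2) atTop (nhds 0) := by
    simpa using (hα0.const_mul 2).mul_const (D ^ 2)
  refine hK.not_ge (ge_of_tendsto hKlim ?_)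
  filter_upwards [hD] with n hn
  have := (hα n).1
  calc K ≤ ⟪d n, g (n + 1) - g n⟫ := hKd n
    _ ≤ 2 * α n * ‖d n‖ ^ 2 := inner_le_two_mul_norm_sq (hK.trans_le (hKd n)) (hy n)
    _ ≤ 2 * α n * D ^ 2 := by gcongr
end

section
/- Suppose that there exists c > 0 such that ⟨x_n − T(x_n), d_n⟩ ≤ −c ‖x_n − T(x_n)‖² for all n ∈ ℕ. Then for all n ∈ ℕ, ⟨d_n, y_n⟩ ≥ (1 − σ) c ‖x_n − T(x_n)‖², where y_n := (x_{n+1} − T(x_{n+1})) − (x_n − T(x_n)); in particular, if in addition ‖x_n − T(x_n)‖ ≥ γ > 0 for all n, then ⟨d_n, y_n⟩ ≥ (1 − σ) c γ² > 0. -/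
open RealInnerProductSpace Filter

/-- Under the sufficient descent condition, ⟪d n, y n⟫ ≥ (1 − σ) c ‖x n − T (x n)‖²;
in particular if ‖x n − T (x n)‖ ≥ γ > 0 for all n, then ⟪d n, y n⟫ ≥ (1 − σ) c γ² > 0. -/
theorem stmt_16 {H : Type*} [NormedAddCommGroup H] [InnerProductSpace ℝ H] [CompleteSpace H]
    (T : H → H) (hT : ∀ x y : H, ‖T x - T y‖ ≤ ‖x - y‖) (hFix : ∃ p : H, T p = p)
    (δ σ : ℝ) (hδ : δ ∈ Set.Ioo (0:ℝ) 1) (hσ : σ ∈ Set.Ioo (0:ℝ) 1) (hδσ : δ ≤ σ)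
    (x d : ℕ → H) (α : ℕ → ℝ) (hα : ∀ n, α n ∈ Set.Ioc (0:ℝ) 1)
    (hx : ∀ n, x (n+1) = x n + α n • d n)
    (hA : ∀ n, ‖x (n+1) - T (x (n+1))‖ ^ 2 - ‖x n - T (x n)‖ ^ 2
      ≤ δ * α n * ⟪x n - T (x n), d n⟫)
    (hW : ∀ n, σ * ⟪x n - T (x n), d n⟫ ≤ ⟪x (n+1) - T (x (n+1)), d n⟫)
    (c : ℝ) (hc : 0 < c)
    (hdesc : ∀ n, ⟪x n - T (x n), d n⟫ ≤ -c * ‖x n - T (x n)‖ ^ 2) :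
    (∀ n, (1 - σ) * c * ‖x n - T (x n)‖ ^ 2
        ≤ ⟪d n, (x (n+1) - T (x (n+1))) - (x n - T (x n))⟫)
    ∧ (∀ γ : ℝ, 0 < γ → (∀ n, γ ≤ ‖x n - T (x n)‖) →
        (0 < (1 - σ) * c * γ ^ 2 ∧
          ∀ n, (1 - σ) * c * γ ^ 2
            ≤ ⟪d n, (x (n+1) - T (x (n+1))) - (x n - T (x n))⟫)) := by
  have hσ' : 0 < 1 - σ := sub_pos.2 hσ.2
  have key : ∀ n, (1 - σ) * c * ‖x n - T (x n)‖ ^ 2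
      ≤ ⟪d n, (x (n+1) - T (x (n+1))) - (x n - T (x n))⟫ := by
    intro n
    rw [inner_sub_right, real_inner_comm (x (n+1) - T (x (n+1))) (d n),
      real_inner_comm (x n - T (x n)) (d n)]
    linarith [hW n, mul_le_mul_of_nonneg_left (hdesc n) hσ'.le]
  refine ⟨key, fun γ hγ hlow => ⟨by positivity, fun n => le_trans ?_ (key n)⟩⟩
  have := hlow n
  gcongr
end

section
/- Suppose that d_n = −(x_n − T(x_n)) for all n ∈ ℕ (the steepest-descent direction, i.e., β_n = 0). Then for all n ∈ ℕ, ‖x_n − T(x_n)‖ ≤ ‖x_0 − T(x_0)‖ / √(δ ∑_{k=0}^n α_k). -/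
open RealInnerProductSpace Filter

/-- A nonnegative sequence with `r (n+1) ≤ (1 - t n) * r n` decays at least like the inverse of
the partial sums of `t`. -/
theorem mul_one_add_sum_range_le {r t : ℕ → ℝ} (hr : ∀ n, 0 ≤ r n) (ht : ∀ n, 0 ≤ t n)
    (h : ∀ n, r (n+1) ≤ (1 - t n) * r n) (n : ℕ) :
    r n * (1 + ∑ k ∈ Finset.range n, t k) ≤ r 0 := by
  induction n with
  | zero => simp
  | succ n ih =>
    rw [Finset.sum_range_succ]
    have hS : 0 ≤ ∑ k ∈ Finset.range n, t k := Finset.sum_nonneg fun k _ => ht k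
    set S := ∑ k ∈ Finset.range n, t k
    have htn := ht n
    calc r (n+1) * (1 + (S + t n)) ≤ (1 - t n) * r n * (1 + (S + t n)) := by
          gcongr
          exact h n
      _ = r n * (1 + S) - r n * (t n * (S + t n)) := by ring
      _ ≤ r n * (1 + S) := sub_le_self _ (mul_nonneg (hr n) (by positivity))
      _ ≤ r 0 := ih

/-- Convergence rate of the steepest-descent fixed point algorithm under the
Wolfe-type conditions. -/
theorem stmt_17 {H : Type*} [NormedAddCommGroup H] [InnerProductSpace ℝ H] [CompleteSpace H]
    (T : H → H) (hT : ∀ x y : H, ‖T x - T y‖ ≤ ‖x - y‖) (hFix : ∃ p : H, T p = p)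
    (δ σ : ℝ) (hδ : δ ∈ Set.Ioo (0:ℝ) 1) (hσ : σ ∈ Set.Ioo (0:ℝ) 1) (hδσ : δ ≤ σ)
    (x d : ℕ → H) (α : ℕ → ℝ) (hα : ∀ n, α n ∈ Set.Ioc (0:ℝ) 1)
    (hx : ∀ n, x (n+1) = x n + α n • d n)
    (hA : ∀ n, ‖x (n+1) - T (x (n+1))‖ ^ 2 - ‖x n - T (x n)‖ ^ 2
      ≤ δ * α n * ⟪x n - T (x n), d n⟫)
    (hW : ∀ n, σ * ⟪x n - T (x n), d n⟫ ≤ ⟪x (n+1) - T (x (n+1)), d n⟫)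
    (hd : ∀ n, d n = -(x n - T (x n))) :
    ∀ n : ℕ, ‖x n - T (x n)‖
      ≤ ‖x 0 - T (x 0)‖ / Real.sqrt (δ * ∑ k ∈ Finset.range (n+1), α k) := by
  intro n
  obtain ⟨hδ0, hδ1⟩ := hδ
  have ht : ∀ k, 0 < δ * α k := fun k => mul_pos hδ0 (hα k).1
  have hdecay : ∀ k, ‖x (k+1) - T (x (k+1))‖ ^ 2 ≤ (1 - δ * α k) * ‖x k - T (x k)‖ ^ 2 := by
    intro k
    have hk := hA k
    rw [hd k, inner_neg_right, real_inner_self_eq_norm_sq] at hk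
    linarith
  have hmain := mul_one_add_sum_range_le (fun k => sq_nonneg ‖x k - T (x k)‖)
    (fun k => (ht k).le) hdecay n
  have hsum : 0 < δ * ∑ k ∈ Finset.range (n+1), α k :=
    mul_pos hδ0 (Finset.sum_pos (fun k _ => (hα k).1) Finset.nonempty_range_add_one)
  rw [le_div_iff₀ (Real.sqrt_pos.2 hsum)]
  refine abs_le_of_sq_le_sq' ?_ (norm_nonneg _) |>.2
  rw [mul_pow, Real.sq_sqrt hsum.le, Finset.mul_sum, Finset.sum_range_succ]
  refine le_trans (mul_le_mul_of_nonneg_left ?_ (sq_nonneg _)) hmain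
  have hle : δ * α n ≤ 1 := mul_le_one₀ hδ1.le (hα n).1.le (hα n).2
  linarith
end

section
/- Suppose that the Dai–Yuan formula β_n = β_n^DY := ‖x_{n+1} − T(x_{n+1})‖² / ⟨d_n, y_n⟩ is used under the strong Wolfe-type conditions, and that ‖x_n − T(x_n)‖ ≠ 0 for all n ∈ ℕ. Then for all n ∈ ℕ, ‖x_n − T(x_n)‖ ≤ ‖x_0 − T(x_0)‖ / √( (δ/(1+σ)) ∑_{k=0}^n α_k ). -/
open RealInnerProductSpace Filter

/-- Sufficient descent of the Dai–Yuan directions: one step. -/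
theorem daiYuan_descent_step {H : Type*} [NormedAddCommGroup H] [InnerProductSpace ℝ H]
    {σ : ℝ} (hσ : σ ∈ Set.Ioo (0:ℝ) 1) {g g' d : H} (hq : ⟪g, d⟫ < 0)
    (hSW : |⟪g', d⟫| ≤ -σ * ⟪g, d⟫) :
    (1 + σ) * ⟪g', -g' + (‖g'‖ ^ 2 / ⟪d, g' - g⟫) • d⟫ ≤ -‖g'‖ ^ 2 := by
  obtain ⟨h0, h1⟩ := hσ
  obtain ⟨hl, hu⟩ := abs_le.mp hSW
  have hD : ⟪d, g' - g⟫ = ⟪g', d⟫ - ⟪g, d⟫ := by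
    rw [inner_sub_right, real_inner_comm, real_inner_comm d g]
  have hpos : 0 < ⟪g', d⟫ - ⟪g, d⟫ := by nlinarith
  rw [inner_add_right, inner_neg_right, real_inner_self_eq_norm_sq, inner_smul_right, hD]
  have key : (1 + σ) * (-‖g'‖ ^ 2 + ‖g'‖ ^ 2 / (⟪g', d⟫ - ⟪g, d⟫) * ⟪g', d⟫)
      = ‖g'‖ ^ 2 * ((1 + σ) * ⟪g, d⟫ / (⟪g', d⟫ - ⟪g, d⟫)) := by
    field_simp
    ring
  have hle : (1 + σ) * ⟪g, d⟫ / (⟪g', d⟫ - ⟪g, d⟫) ≤ -1 := by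
    rw [div_le_iff₀ hpos]
    linarith
  rw [key]
  nlinarith [mul_le_mul_of_nonneg_left hle (sq_nonneg ‖g'‖)]

/-- A nonnegative sequence with `f (n+1) ≤ f n - c * a n * f n` decays at least like the
reciprocal of the partial sums of `c * a`. -/
theorem mul_sum_mul_le_of_decrease {f a : ℕ → ℝ} {c : ℝ} (hc : 0 ≤ c) (ha : ∀ n, 0 ≤ a n)
    (hf : ∀ n, 0 ≤ f n) (h : ∀ n, f (n+1) - f n ≤ -(c * a n * f n)) (n : ℕ) :
    c * (∑ k ∈ Finset.range (n+1), a k) * f n ≤ f 0 := by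
  have hanti : Antitone f := antitone_nat_of_succ_le fun n => by
    linarith [h n, mul_nonneg (mul_nonneg hc (ha n)) (hf n)]
  calc c * (∑ k ∈ Finset.range (n+1), a k) * f n
      = ∑ k ∈ Finset.range (n+1), c * a k * f n := by rw [Finset.mul_sum, Finset.sum_mul]
    _ ≤ ∑ k ∈ Finset.range (n+1), (f k - f (k+1)) := by
        refine Finset.sum_le_sum fun k hk => ?_
        have := mul_le_mul_of_nonneg_left (hanti (Finset.mem_range_succ_iff.mp hk))
          (mul_nonneg hc (ha k))
        linarith [h k]
    _ = f 0 - f (n+1) := Finset.sum_range_sub' f (n+1)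
    _ ≤ f 0 := sub_le_self _ (hf _)

/-- Convergence rate of the Dai–Yuan fixed point algorithm under the strong
Wolfe-type conditions. -/
theorem stmt_18 {H : Type*} [NormedAddCommGroup H] [InnerProductSpace ℝ H] [CompleteSpace H]
    (T : H → H) (hT : ∀ x y : H, ‖T x - T y‖ ≤ ‖x - y‖) (hFix : ∃ p : H, T p = p)
    (δ σ : ℝ) (hδ : δ ∈ Set.Ioo (0:ℝ) 1) (hσ : σ ∈ Set.Ioo (0:ℝ) 1) (hδσ : δ ≤ σ)
    (x d : ℕ → H) (α : ℕ → ℝ) (β : ℕ → ℝ) (hα : ∀ n, α n ∈ Set.Ioc (0:ℝ) 1)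
    (hx : ∀ n, x (n+1) = x n + α n • d n)
    (hA : ∀ n, ‖x (n+1) - T (x (n+1))‖ ^ 2 - ‖x n - T (x n)‖ ^ 2
      ≤ δ * α n * ⟪x n - T (x n), d n⟫)
    (hSW : ∀ n, |⟪x (n+1) - T (x (n+1)), d n⟫| ≤ -σ * ⟪x n - T (x n), d n⟫)
    (hd0 : d 0 = -(x 0 - T (x 0)))
    (hd : ∀ n, d (n+1) = -(x (n+1) - T (x (n+1))) + β n • d n)
    (hβ : ∀ n, β n = ‖x (n+1) - T (x (n+1))‖ ^ 2
      / ⟪d n, (x (n+1) - T (x (n+1))) - (x n - T (x n))⟫)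
    (hnz : ∀ n, ‖x n - T (x n)‖ ≠ 0) :
    ∀ n : ℕ, ‖x n - T (x n)‖
      ≤ ‖x 0 - T (x 0)‖
        / Real.sqrt (δ / (1 + σ) * ∑ k ∈ Finset.range (n+1), α k) := by
  have h1σ : 0 < 1 + σ := by linarith [hσ.1]
  have hc : 0 < δ / (1 + σ) := div_pos hδ.1 h1σ
  have hdesc : ∀ n, (1 + σ) * ⟪x n - T (x n), d n⟫ ≤ -‖x n - T (x n)‖ ^ 2 := by
    intro n
    induction n with
    | zero =>
      rw [hd0, inner_neg_right, real_inner_self_eq_norm_sq]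
      nlinarith [hσ.1, sq_nonneg ‖x 0 - T (x 0)‖]
    | succ n ih =>
      rw [hd n, hβ n]
      refine daiYuan_descent_step hσ ?_ (hSW n)
      have : 0 < ‖x n - T (x n)‖ ^ 2 := by have := hnz n; positivity
      by_contra! hq
      linarith [mul_nonneg h1σ.le hq]
  have hdec : ∀ n, ‖x (n+1) - T (x (n+1))‖ ^ 2 - ‖x n - T (x n)‖ ^ 2
      ≤ -(δ / (1 + σ) * α n * ‖x n - T (x n)‖ ^ 2) := by
    intro n
    refine (hA n).trans ?_
    have h := mul_le_mul_of_nonneg_left (hdesc n) (mul_nonneg hc.le (hα n).1.le)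
    have e : δ / (1 + σ) * α n * ((1 + σ) * ⟪x n - T (x n), d n⟫)
        = δ * α n * ⟪x n - T (x n), d n⟫ := by field_simp
    linarith
  intro n
  have hS : 0 < δ / (1 + σ) * ∑ k ∈ Finset.range (n+1), α k :=
    mul_pos hc (Finset.sum_pos (fun k _ => (hα k).1) (by simp))
  have hmain := mul_sum_mul_le_of_decrease (f := fun n => ‖x n - T (x n)‖ ^ 2) hc.le
    (fun n => (hα n).1.le) (fun n => sq_nonneg _) hdec n
  rw [le_div_iff₀ (Real.sqrt_pos.mpr hS)]
  refine abs_le_of_sq_le_sq' ?_ (norm_nonneg _) |>.2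
  rw [mul_pow, Real.sq_sqrt hS.le, mul_comm]
  exact hmain
end

section
/- Suppose that the Fletcher–Reeves formula β_n = β_n^FR := ‖x_{n+1} − T(x_{n+1})‖² / ‖x_n − T(x_n)‖² is used under the strong Wolfe-type conditions with σ ∈ (0,1/2], and that ‖x_n − T(x_n)‖ ≠ 0 for all n ∈ ℕ. Then for all n ∈ ℕ, ‖x_n − T(x_n)‖ ≤ ‖x_0 − T(x_0)‖ / √( (δ/(1−σ)) ∑_{k=0}^n (1 − 2σ + σ^k) α_k ). -/
open RealInnerProductSpace Filter

/-- Descent estimate for the Fletcher–Reeves directions: if `a (n+1)` differs from `-f (n+1)` by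
`f (n+1) / f n` times a quantity of size at most `-σ * a n`, then `a n / f n` lies between the
geometric bounds. -/
lemma fletcherReeves_descent {σ : ℝ} (hσ : 0 ≤ σ) {f a b : ℕ → ℝ} (hf : ∀ n, 0 < f n)
    (h0 : a 0 = -f 0) (ha : ∀ n, a (n + 1) = -f (n + 1) + f (n + 1) / f n * b n)
    (hb : ∀ n, |b n| ≤ -σ * a n) (hσ1 : σ < 1) (n : ℕ) :
    -((1 - σ ^ (n + 1)) * f n) ≤ (1 - σ) * a n ∧
      (1 - σ) * a n ≤ -((1 - 2 * σ + σ ^ (n + 1)) * f n) := by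
  induction n with
  | zero => rw [h0]; constructor <;> apply le_of_eq <;> ring
  | succ n ih =>
    have hbn : (1 - σ) * |b n| ≤ σ * (1 - σ ^ (n + 1)) * f n := by
      have h1 := mul_le_mul_of_nonneg_left (hb n) (sub_nonneg.2 hσ1.le)
      have h2 := mul_le_mul_of_nonneg_left ih.1 hσ
      linarith
    have hr : 0 ≤ f (n + 1) / f n := (div_pos (hf _) (hf n)).le
    have key : (1 - σ) * (f (n + 1) / f n * |b n|) ≤ σ * (1 - σ ^ (n + 1)) * f (n + 1) :=
      calc (1 - σ) * (f (n + 1) / f n * |b n|) = f (n + 1) / f n * ((1 - σ) * |b n|) := by ring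
        _ ≤ f (n + 1) / f n * (σ * (1 - σ ^ (n + 1)) * f n) := mul_le_mul_of_nonneg_left hbn hr
        _ = σ * (1 - σ ^ (n + 1)) * f (n + 1) := by
          have := (hf n).ne'
          field_simp
    have hs : 0 ≤ (1 - σ) * (f (n + 1) / f n) := mul_nonneg (sub_nonneg.2 hσ1.le) hr
    have hlo := mul_le_mul_of_nonneg_left (neg_abs_le (b n)) hs
    have hhi := mul_le_mul_of_nonneg_left (le_abs_self (b n)) hs
    rw [ha n, pow_succ σ (n + 1)]
    constructor <;> linarith

/-- A positive sequence with `f (n+1) ≤ f n - w n * f n` decays at least like the inverse of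
`1 + ∑ w`. -/
lemma mul_one_add_sum_le_of_decrease {f w : ℕ → ℝ} (hf : ∀ n, 0 ≤ f n) (hw : ∀ n, 0 ≤ w n)
    (h : ∀ n, f (n + 1) ≤ f n - w n * f n) (n : ℕ) :
    f n * (1 + ∑ k ∈ Finset.range n, w k) ≤ f 0 := by
  induction n with
  | zero => simp
  | succ n ih =>
    have hS : 0 ≤ ∑ k ∈ Finset.range n, w k := Finset.sum_nonneg fun k _ => hw k
    have hmono : f (n + 1) ≤ f n := by linarith [h n, mul_nonneg (hw n) (hf n)]
    rw [Finset.sum_range_succ]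
    linarith [h n, mul_le_mul_of_nonneg_left hmono (hw n), mul_le_mul_of_nonneg_right hmono hS]

/-- Comparison of the weights `1 - 2σ + σ ^ k` with the shifted weights `1 - 2σ + σ ^ (k+1)`. -/
lemma sum_weights_le {σ : ℝ} (hσ : 0 ≤ σ) (hσhalf : σ ≤ 1 / 2) {α : ℕ → ℝ}
    (hα : ∀ n, α n ≤ 1) (n : ℕ) :
    ∑ k ∈ Finset.range (n + 1), (1 - 2 * σ + σ ^ k) * α k ≤
      2 * (1 - σ) + ∑ k ∈ Finset.range n, (1 - 2 * σ + σ ^ (k + 1)) * α k := by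
  have hshift : ∑ k ∈ Finset.range n, (1 - 2 * σ + σ ^ k) * α k ≤
      ∑ k ∈ Finset.range n, ((1 - 2 * σ + σ ^ (k + 1)) * α k + σ ^ k * (1 - σ)) := by
    refine Finset.sum_le_sum fun k _ => ?_
    have : 0 ≤ σ ^ k * (1 - σ) := mul_nonneg (pow_nonneg hσ k) (by linarith)
    have := mul_le_mul_of_nonneg_left (hα k) this
    rw [pow_succ]
    linarith
  have hlast : (1 - 2 * σ + σ ^ n) * α n ≤ 1 - 2 * σ + σ ^ n :=
    mul_le_of_le_one_right (by linarith [pow_nonneg hσ n]) (hα n)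
  rw [Finset.sum_add_distrib, ← Finset.sum_mul, geom_sum_mul_neg] at hshift
  rw [Finset.sum_range_succ]
  linarith

/-- Convergence rate of the Fletcher–Reeves fixed point algorithm under the strong
Wolfe-type conditions with σ ∈ (0, 1/2]. -/
theorem stmt_19 {H : Type*} [NormedAddCommGroup H] [InnerProductSpace ℝ H] [CompleteSpace H]
    (T : H → H) (hT : ∀ x y : H, ‖T x - T y‖ ≤ ‖x - y‖) (hFix : ∃ p : H, T p = p)
    (δ σ : ℝ) (hδ : δ ∈ Set.Ioo (0:ℝ) 1) (hσ : σ ∈ Set.Ioo (0:ℝ) 1) (hδσ : δ ≤ σ)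
    (hσhalf : σ ≤ 1/2)
    (x d : ℕ → H) (α : ℕ → ℝ) (β : ℕ → ℝ) (hα : ∀ n, α n ∈ Set.Ioc (0:ℝ) 1)
    (hx : ∀ n, x (n+1) = x n + α n • d n)
    (hA : ∀ n, ‖x (n+1) - T (x (n+1))‖ ^ 2 - ‖x n - T (x n)‖ ^ 2
      ≤ δ * α n * ⟪x n - T (x n), d n⟫)
    (hSW : ∀ n, |⟪x (n+1) - T (x (n+1)), d n⟫| ≤ -σ * ⟪x n - T (x n), d n⟫)
    (hd0 : d 0 = -(x 0 - T (x 0)))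
    (hd : ∀ n, d (n+1) = -(x (n+1) - T (x (n+1))) + β n • d n)
    (hβ : ∀ n, β n = ‖x (n+1) - T (x (n+1))‖ ^ 2 / ‖x n - T (x n)‖ ^ 2)
    (hnz : ∀ n, ‖x n - T (x n)‖ ≠ 0) :
    ∀ n : ℕ, ‖x n - T (x n)‖
      ≤ ‖x 0 - T (x 0)‖
        / Real.sqrt (δ / (1 - σ)
            * ∑ k ∈ Finset.range (n+1), (1 - 2*σ + σ ^ k) * α k) := by
  intro n
  obtain ⟨hδ0, -⟩ := hδ
  obtain ⟨hσ0, hσ1⟩ := hσ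
  have hσ' : 0 < 1 - σ := by linarith
  set f : ℕ → ℝ := fun n => ‖x n - T (x n)‖ ^ 2 with hf_def
  have hf : ∀ n, 0 < f n := fun n => by have := hnz n; positivity
  have hdesc := fletcherReeves_descent hσ0.le (f := f) (a := fun n => ⟪x n - T (x n), d n⟫)
    (b := fun n => ⟪x (n+1) - T (x (n+1)), d n⟫) hf
    (by simp only [hf_def, hd0, inner_neg_right, real_inner_self_eq_norm_sq])
    (fun n => by
      simp only [hf_def, hd, hβ, inner_add_right, inner_neg_right, inner_smul_right,
        real_inner_self_eq_norm_sq])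
    hSW hσ1
  have hdec : ∀ k, f (k + 1) ≤ f k - δ / (1 - σ) * ((1 - 2*σ + σ ^ (k + 1)) * α k) * f k := by
    intro k
    have h := mul_le_mul_of_nonneg_left (hdesc k).2
      (mul_nonneg (div_nonneg hδ0.le hσ'.le) (hα k).1.le)
    have e : δ / (1 - σ) * α k * ((1 - σ) * ⟪x k - T (x k), d k⟫) =
        δ * α k * ⟪x k - T (x k), d k⟫ := by field_simp
    have hAk : f (k + 1) - f k ≤ δ * α k * ⟪x k - T (x k), d k⟫ := hA k
    linarith
  have hw : ∀ k, 0 ≤ δ / (1 - σ) * ((1 - 2*σ + σ ^ (k + 1)) * α k) := fun k =>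
    mul_nonneg (div_nonneg hδ0.le hσ'.le)
      (mul_nonneg (by linarith [pow_pos hσ0 (k + 1)]) (hα k).1.le)
  have hrate := mul_one_add_sum_le_of_decrease (fun n => (hf n).le) hw hdec n
  set S := δ / (1 - σ) * ∑ k ∈ Finset.range (n+1), (1 - 2*σ + σ ^ k) * α k
  have hS : 0 < S := mul_pos (div_pos hδ0 hσ') <| Finset.sum_pos
    (fun k _ => mul_pos (by linarith [pow_pos hσ0 k]) (hα k).1) (by simp)
  have hSle : S ≤ 1 + ∑ k ∈ Finset.range n, δ / (1 - σ) * ((1 - 2*σ + σ ^ (k + 1)) * α k) := by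
    have h := mul_le_mul_of_nonneg_left (sum_weights_le hσ0.le hσhalf (fun k => (hα k).2) n)
      (div_nonneg hδ0.le hσ'.le)
    have e : δ / (1 - σ) * (2 * (1 - σ)) = 2 * δ := by field_simp
    rw [← Finset.mul_sum]
    linarith
  rw [le_div_iff₀ (Real.sqrt_pos.2 hS)]
  refine le_of_abs_le (abs_le_of_sq_le_sq ?_ (norm_nonneg _))
  rw [mul_pow, Real.sq_sqrt hS.le]
  exact (mul_le_mul_of_nonneg_left hSle (hf n).le).trans hrate
end
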